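/- Let 𝔣 be an additive, κ-Lipschitz, concave graph parameter, let μ be a probability measure on ℕ with finite mean, and let {d_n}_{n≥1} be a sequence of degree functions approaching μ. Then the limit Ψ(μ) := lim_{n→∞} E[𝔣(𝔾^iid_{μ,n})]/n exists in ℝ, and under any coupling of the random graphs {𝔾_{d_n}}_{n≥1} one has the almost-sure convergence 𝔣(𝔾_{d_n})/n → Ψ(μ) as n → ∞; in particular the limit does not depend on the particular sequence {d_n} approaching μ. -/

import Mathlib

open Finset Filter Topology MeasureTheory
open scoped Classical BigOperators ENNReal

structure Multigraph where
  (V : Type)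
  [fintypeV : Fintype V]
  (edges : Multiset (Sym2 V))

attribute [instance] Multigraph.fintypeV

def Multigraph.addEdge (G : Multigraph) (i j : G.V) : Multigraph :=
  { V := G.V, edges := s(i, j) ::ₘ G.edges }

def Multigraph.disjUnion (G₁ G₂ : Multigraph) : Multigraph :=
  { V := G₁.V ⊕ G₂.V,
    edges := G₁.edges.map (Sym2.map Sum.inl) + G₂.edges.map (Sym2.map Sum.inr) }

/-- A graph parameter is invariant under graph isomorphism. -/
def GraphParam.Invariant (f : Multigraph → ℝ) : Prop :=
  ∀ (G₁ G₂ : Multigraph) (e : G₁.V ≃ G₂.V),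
    G₂.edges = G₁.edges.map (Sym2.map e) → f G₁ = f G₂

def GraphParam.Additive (f : Multigraph → ℝ) : Prop :=
  ∀ G₁ G₂ : Multigraph, f (G₁.disjUnion G₂) = f G₁ + f G₂

def GraphParam.Lipschitz (f : Multigraph → ℝ) (κ : ℝ) : Prop :=
  ∀ (G : Multigraph) (i j : G.V), |f (G.addEdge i j) - f G| ≤ κ

def GraphParam.Concave (f : Multigraph → ℝ) : Prop :=
  ∀ (G : Multigraph) (x : G.V → ℝ), (∑ i, x i) = 0 →
    ∑ i, ∑ j, (f (G.addEdge i j) - f G) * x i * x j ≤ 0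

abbrev HalfEdge (V : Type) (d : V → ℕ) : Type := Σ i : V, Fin (d i)

def IsPairMatching {α : Type} (m : Finset (Sym2 α)) : Prop :=
  (∀ p ∈ m, ¬ p.IsDiag) ∧
    ∀ p ∈ m, ∀ q ∈ m, p ≠ q → ∀ h : α, h ∈ p → h ∉ q

def IsMaximalMatching {α : Type} (m : Finset (Sym2 α)) : Prop :=
  IsPairMatching m ∧ ∀ m' : Finset (Sym2 α), IsPairMatching m' → m ⊆ m' → m' = m

/-- The multigraph `G[m]` induced on `V` by a matching `m` of the half-edges. -/
def matchingGraph (V : Type) [Fintype V] (d : V → ℕ)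
    (m : Finset (Sym2 (HalfEdge V d))) : Multigraph :=
  { V := V, edges := m.val.map (Sym2.map Sigma.fst) }

noncomputable def maximalMatchings (V : Type) [Fintype V] [DecidableEq V] (d : V → ℕ) :
    Finset (Finset (Sym2 (HalfEdge V d))) :=
  Finset.univ.filter fun m => IsMaximalMatching m

/-- `E[f(𝔾_d)]`: expectation of `f` under the configuration model with degrees `d`. -/
noncomputable def configExpect (V : Type) [Fintype V] [DecidableEq V] (d : V → ℕ)
    (f : Multigraph → ℝ) : ℝ :=
  (∑ m ∈ maximalMatchings V d, f (matchingGraph V d m)) / ((maximalMatchings V d).card : ℝ)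

/-- `E[f(𝔾^iid_{μ,n})]`. -/
noncomputable def iidExpect (μ : ℕ → ℝ) (n : ℕ) (f : Multigraph → ℝ) : ℝ :=
  ∑' D : Fin n → ℕ, (∏ i, μ (D i)) * configExpect (Fin n) D f

noncomputable def tailSum (μ : ℕ → ℝ) (i : ℕ) : ℝ := ∑' k : ℕ, if i ≤ k then μ k else 0

/-- The Wasserstein distance `W(μ, μ') = Σ_{i≥1} |Σ_{k≥i} (μ k - μ' k)|`. -/
noncomputable def wasserstein (μ μ' : ℕ → ℝ) : ℝ :=
  ∑' i : ℕ, |tailSum μ (i + 1) - tailSum μ' (i + 1)|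

/-- Empirical degree distribution of `d : Fin n → ℕ`. -/
noncomputable def empirical (n : ℕ) (d : Fin n → ℕ) : ℕ → ℝ :=
  fun k => ((Finset.univ.filter fun i => d i = k).card : ℝ) / (n : ℝ)

/-- The degree sequences `d n` approach the degree distribution `μ` (with mean `Σ k·μ(k)`). -/
def Approaches (d : (n : ℕ) → Fin n → ℕ) (μ : ℕ → ℝ) : Prop :=
  (∀ k : ℕ, Tendsto (fun n => empirical n (d n) k) atTop (nhds (μ k))) ∧
    Tendsto (fun n => (∑ i, (d n i : ℝ)) / (n : ℝ)) atTop
      (nhds (∑' k : ℕ, (k : ℝ) * μ k))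

/-! ### Matchings as multisets of unordered pairs -/

/-- The multiset of endpoints of a multiset of pairs. -/
def endp {H : Type} (E : Multiset (Sym2 H)) : Multiset H := E.bind Sym2.toMultiset

/-- A multiset of pairs is a matching if its endpoints are all distinct. -/
def IsM {H : Type} (E : Multiset (Sym2 H)) : Prop := (endp E).Nodup

theorem toMultiset_mk {H : Type} (x y : H) : (s(x, y)).toMultiset = {x, y} := rfl

theorem toMultiset_map {H K : Type} (g : H → K) (e : Sym2 H) :
    (Sym2.map g e).toMultiset = e.toMultiset.map g := by
  induction e with
  | h x y => simp [toMultiset_mk]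

theorem endp_zero {H : Type} : endp (0 : Multiset (Sym2 H)) = 0 := by simp [endp]

theorem endp_cons {H : Type} (e : Sym2 H) (E : Multiset (Sym2 H)) :
    endp (e ::ₘ E) = e.toMultiset + endp E := by simp [endp]

theorem endp_add {H : Type} (E E' : Multiset (Sym2 H)) :
    endp (E + E') = endp E + endp E' := by simp [endp]

theorem endp_map {H K : Type} (g : H → K) (E : Multiset (Sym2 H)) :
    endp (E.map (Sym2.map g)) = (endp E).map g := by
  simp [endp, Multiset.bind_map, Multiset.map_bind, toMultiset_map]

theorem card_endp {H : Type} (E : Multiset (Sym2 H)) :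
    (endp E).card = 2 * E.card := by
  simp [endp, Multiset.card_bind, Sym2.card_toMultiset, mul_comm]

theorem endp_mono {H : Type} {E E' : Multiset (Sym2 H)} (h : E ≤ E') : endp E ≤ endp E' := by
  obtain ⟨R, rfl⟩ := Multiset.le_iff_exists_add.1 h
  rw [endp_add]; exact Multiset.le_add_right _ _

theorem mem_endp {H : Type} {E : Multiset (Sym2 H)} {h : H} :
    h ∈ endp E ↔ ∃ e ∈ E, h ∈ e := by
  simp [endp, Multiset.mem_bind, Sym2.mem_toMultiset]

theorem IsM.mono {H : Type} {E E' : Multiset (Sym2 H)} (h : E ≤ E') (hE : IsM E') : IsM E :=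
  Multiset.nodup_of_le (endp_mono h) hE

theorem isM_zero {H : Type} : IsM (0 : Multiset (Sym2 H)) := by simp [IsM, endp_zero]

theorem isM_cons {H : Type} {x y : H} {E : Multiset (Sym2 H)} :
    IsM (s(x, y) ::ₘ E) ↔ x ≠ y ∧ x ∉ endp E ∧ y ∉ endp E ∧ IsM E := by
  simp only [IsM, endp_cons, toMultiset_mk]
  simp only [Multiset.insert_eq_cons, Multiset.cons_add, Multiset.singleton_add,
    Multiset.nodup_cons, Multiset.mem_cons, not_or]
  tauto

theorem IsM.map {H K : Type} {E : Multiset (Sym2 H)} {g : H → K} (hg : Function.Injective g)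
    (hE : IsM E) : IsM (E.map (Sym2.map g)) := by
  unfold IsM; rw [endp_map]; exact Multiset.Nodup.map hg hE

theorem IsM.nodup {H : Type} {E : Multiset (Sym2 H)} (hE : IsM E) : E.Nodup := by
  induction E using Multiset.induction_on with
  | empty => simp
  | cons e E ih =>
    induction e with
    | h x y =>
      rw [isM_cons] at hE
      rw [Multiset.nodup_cons]
      refine ⟨fun h => hE.2.1 (mem_endp.2 ⟨_, h, by simp⟩), ih hE.2.2.2⟩

theorem isPairMatching_iff {H : Type} (m : Finset (Sym2 H)) :
    IsPairMatching m ↔ IsM m.val := by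
  induction m using Finset.induction_on with
  | empty => simp [IsPairMatching, isM_zero]
  | insert e m he ih =>
    rw [Finset.insert_val_of_notMem he]
    induction e with
    | h x y =>
      rw [isM_cons, ← ih]
      simp only [mem_endp, Finset.mem_val, not_exists, not_and]
      constructor
      · rintro ⟨h1, h2⟩
        refine ⟨?_, ?_, ?_, ?_, ?_⟩
        · have := h1 _ (Finset.mem_insert_self _ _); simpa using this
        · intro q hq
          exact h2 _ (Finset.mem_insert_self _ _) q (Finset.mem_insert_of_mem hq)
            (by rintro rfl; exact he hq) x (by simp)
        · intro q hq
          exact h2 _ (Finset.mem_insert_self _ _) q (Finset.mem_insert_of_mem hq)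
            (by rintro rfl; exact he hq) y (by simp)
        · intro p hp; exact h1 p (Finset.mem_insert_of_mem hp)
        · intro p hp q hq
          exact h2 p (Finset.mem_insert_of_mem hp) q (Finset.mem_insert_of_mem hq)
      · rintro ⟨hxy, hx, hy, h1, h2⟩
        refine ⟨?_, ?_⟩
        · intro p hp
          rcases Finset.mem_insert.1 hp with rfl | hp
          · simpa using hxy
          · exact h1 p hp
        · intro p hp q hq hpq h hhp hhq
          rcases Finset.mem_insert.1 hp with rfl | hp' <;>
            rcases Finset.mem_insert.1 hq with rfl | hq'
          · exact hpq rfl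
          · rcases Sym2.mem_iff.1 hhp with rfl | rfl
            · exact hx q hq' hhq
            · exact hy q hq' hhq
          · rcases Sym2.mem_iff.1 hhq with rfl | rfl
            · exact hx p hp' hhp
            · exact hy p hp' hhp
          · exact h2 p hp' q hq' hpq h hhp hhq

/-- Colour preserving permutations act transitively enough on matchings. -/
theorem exists_perm_le {H C : Type} (χ : H → C) {E E' : Multiset (Sym2 H)}
    (hE : IsM E) (hE' : IsM E')
    (hle : E.map (Sym2.map χ) ≤ E'.map (Sym2.map χ)) :
    ∃ σ : Equiv.Perm H, (∀ h, χ (σ h) = χ h) ∧ E.map (Sym2.map σ) ≤ E' := by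
  induction E using Multiset.induction_on with
  | empty => exact ⟨1, by simp, by simp⟩
  | cons e E ih =>
    have hE0 : IsM E := hE.mono (Multiset.le_cons_self _ _)
    obtain ⟨σ, hσ, hσE⟩ := ih hE0
      (le_trans (Multiset.map_le_map (Multiset.le_cons_self _ _)) hle)
    obtain ⟨R, rfl⟩ := Multiset.le_iff_exists_add.1 hσE
    have hcomp : (E.map (Sym2.map σ)).map (Sym2.map χ) = E.map (Sym2.map χ) := by
      rw [Multiset.map_map]
      refine Multiset.map_congr rfl (fun e _ => ?_)
      simp only [Function.comp, Sym2.map_map]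
      congr 1; funext h; exact hσ h
    rw [Multiset.map_cons, Multiset.map_add, hcomp, ← Multiset.singleton_add, add_comm,
      Multiset.add_le_add_iff_left, Multiset.singleton_le] at hle
    obtain ⟨e', he', hee⟩ := Multiset.mem_map.1 hle
    obtain ⟨R', rfl⟩ := Multiset.exists_cons_of_mem he'
    induction e with
    | h x y =>
    have : ∃ x' y', e' = s(x', y') ∧ χ x' = χ x ∧ χ y' = χ y := by
      induction e' with
      | h a b =>
        simp only [Sym2.map_mk, Sym2.eq_iff] at hee
        rcases hee with ⟨h1, h2⟩ | ⟨h1, h2⟩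
        · exact ⟨a, b, rfl, h1, h2⟩
        · exact ⟨b, a, Sym2.eq_swap, h2, h1⟩
    obtain ⟨x', y', rfl, hx', hy'⟩ := this
    rw [isM_cons] at hE
    obtain ⟨hxy, hxE, hyE, -⟩ := hE
    have hsub : IsM (s(x', y') ::ₘ E.map (Sym2.map σ)) := by
      refine hE'.mono ?_
      rw [Multiset.add_cons]
      exact Multiset.cons_le_cons _ (Multiset.le_add_right _ _)
    rw [isM_cons, endp_map] at hsub
    obtain ⟨hxy', hx'E, hy'E, -⟩ := hsub
    have hσx : σ x ∉ (endp E).map σ := by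
      rw [Multiset.mem_map_of_injective σ.injective]; exact hxE
    have hσy : σ y ∉ (endp E).map σ := by
      rw [Multiset.mem_map_of_injective σ.injective]; exact hyE
    have hswc : ∀ a b : H, χ a = χ b → ∀ h, χ (Equiv.swap a b h) = χ h := by
      intro a b hab h
      rcases Equiv.swap_apply_eq_iff.1 (rfl : Equiv.swap a b h = Equiv.swap a b h) with _
      by_cases h1 : h = a
      · subst h1; simp [hab]
      by_cases h2 : h = b
      · subst h2; simp [hab]
      rw [Equiv.swap_apply_of_ne_of_ne h1 h2]
    set τ₁ := Equiv.swap (σ x) x' with hτ₁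
    have hc1 : χ (σ x) = χ x' := by rw [hσ, hx']
    set y2 := τ₁ (σ y) with hy2
    have hy2c : χ y2 = χ y' := by rw [hy2, hτ₁, hswc _ _ hc1, hσ, hy']
    have hy2x : y2 ≠ x' := by
      intro h
      have : τ₁ (σ y) = τ₁ (σ x) := by rw [← hy2, h, hτ₁, Equiv.swap_apply_left]
      exact hxy (σ.injective (τ₁.injective this)).symm
    have hfix1 : ∀ z ∈ (endp E).map σ, τ₁ z = z := by
      intro z hz
      exact Equiv.swap_apply_of_ne_of_ne (by rintro rfl; exact hσx hz) (by rintro rfl; exact hx'E hz)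
    have hy2E : y2 ∉ (endp E).map σ := by
      intro h
      have h1 := hfix1 _ h
      have : y2 = σ y := τ₁.injective (by rw [h1])
      rw [this] at h
      exact hσy h
    have hfix2 : ∀ z ∈ (endp E).map σ, Equiv.swap y2 y' z = z := by
      intro z hz
      exact Equiv.swap_apply_of_ne_of_ne (by rintro rfl; exact hy2E hz) (by rintro rfl; exact hy'E hz)
    refine ⟨σ.trans (τ₁.trans (Equiv.swap y2 y')), ?_, ?_⟩
    · intro h
      simp only [Equiv.trans_apply]
      rw [hswc _ _ hy2c, hswc _ _ hc1, hσ]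
    · rw [Multiset.map_cons]
      have e1 : Sym2.map (σ.trans (τ₁.trans (Equiv.swap y2 y'))) s(x, y) = s(x', y') := by
        simp only [Sym2.map_mk, Equiv.trans_apply]
        rw [← hy2, Equiv.swap_apply_left, Equiv.swap_apply_of_ne_of_ne hy2x.symm hxy',
          Equiv.swap_apply_left]
      have e2 : E.map (Sym2.map (σ.trans (τ₁.trans (Equiv.swap y2 y')))) = E.map (Sym2.map σ) := by
        refine Multiset.map_congr rfl (fun e he => ?_)
        refine Sym2.map_congr (fun h hh => ?_)
        have hz : σ h ∈ (endp E).map σ := Multiset.mem_map_of_mem _ (mem_endp.2 ⟨e, he, hh⟩)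
        simp only [Equiv.trans_apply]
        rw [hfix1 _ hz, hfix2 _ hz]
      rw [e1, e2, Multiset.add_cons]
      exact Multiset.cons_le_cons _ (Multiset.le_add_right _ _)

theorem exists_perm_le' {H : Type} {E E' : Multiset (Sym2 H)}
    (hE : IsM E) (hE' : IsM E') (hle : E.card ≤ E'.card) :
    ∃ σ : Equiv.Perm H, E.map (Sym2.map σ) ≤ E' := by
  obtain ⟨σ, -, h⟩ := exists_perm_le (fun _ : H => ()) hE hE' (by
    have h : ∀ F : Multiset (Sym2 H), F.map (Sym2.map (fun _ : H => ())) =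
        Multiset.replicate F.card (s((), ())) := by
      intro F
      rw [Multiset.eq_replicate]
      refine ⟨by simp, fun b _ => ?_⟩
      induction b with
      | h x y => rfl
    rw [h, h]
    exact (Multiset.replicate_le_replicate _).2 hle)
  exact ⟨σ, h⟩

/-- Maximum matchings. -/
def IsMxm {H : Type} (E : Multiset (Sym2 H)) : Prop :=
  IsM E ∧ ∀ E' : Multiset (Sym2 H), IsM E' → E'.card ≤ E.card

theorem isMaximalMatching_iff {H : Type} (m : Finset (Sym2 H)) :
    IsMaximalMatching m ↔ IsMxm m.val := by
  unfold IsMaximalMatching IsMxm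
  rw [isPairMatching_iff]
  constructor
  · rintro ⟨h1, h2⟩
    refine ⟨h1, fun E' hE' => ?_⟩
    by_contra hlt
    push Not at hlt
    obtain ⟨σ, hσ⟩ := exists_perm_le' h1 hE' hlt.le
    have hM : IsM (E'.map (Sym2.map σ.symm)) := hE'.map σ.symm.injective
    have hle : m.val ≤ E'.map (Sym2.map σ.symm) := by
      have := Multiset.map_le_map (f := Sym2.map σ.symm) hσ
      rw [Multiset.map_map] at this
      convert this using 1
      conv_lhs => rw [← Multiset.map_id m.val]
      refine Multiset.map_congr rfl (fun e _ => ?_)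
      simp only [Function.comp, Sym2.map_map, id]
      have : (fun x => σ.symm (σ x)) = id := by funext x; simp
      rw [this]
      simp
    have := h2 ⟨_, hM.nodup⟩ ((isPairMatching_iff _).2 hM) (Finset.val_le_iff.1 hle)
    have h3 := congrArg Finset.card this
    simp only [Finset.card_mk, Multiset.card_map] at h3
    rw [Finset.card_def] at h3
    omega
  · rintro ⟨h1, h2⟩
    refine ⟨h1, fun m' hm' hsub => ?_⟩
    exact (Finset.eq_of_subset_of_card_le hsub (h2 _ ((isPairMatching_iff _).1 hm'))).symm

theorem IsMxm.map {H K : Type} {E : Multiset (Sym2 H)} (hE : IsMxm E) (e : H ≃ K) :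
    IsMxm (E.map (Sym2.map e)) := by
  refine ⟨hE.1.map e.injective, fun E' hE' => ?_⟩
  have := hE.2 _ (hE'.map e.symm.injective)
  simpa using this

/-- The finset of maximal matchings. -/
noncomputable def maxM (H : Type) [Fintype H] : Finset (Finset (Sym2 H)) :=
  Finset.univ.filter fun m => IsMaximalMatching m

theorem mem_maxM {H : Type} [Fintype H] (m : Finset (Sym2 H)) :
    m ∈ maxM H ↔ IsMxm m.val := by
  simp [maxM, isMaximalMatching_iff]

theorem maxM_nonempty (H : Type) [Fintype H] : (maxM H).Nonempty := by
  have hne : (Finset.univ.filter fun m : Finset (Sym2 H) => IsM m.val).Nonempty :=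
    ⟨∅, by simp [isM_zero]⟩
  obtain ⟨m, hm, hmax⟩ := Finset.exists_max_image _ (fun m => m.card) hne
  refine ⟨m, (mem_maxM m).2 ⟨by simpa using hm, fun E' hE' => ?_⟩⟩
  exact hmax ⟨E', hE'.nodup⟩ (by simpa using hE')

/-- Transport of pairs along an equivalence. -/
def symEquiv {H K : Type} (e : H ≃ K) : Sym2 H ≃ Sym2 K where
  toFun := Sym2.map e
  invFun := Sym2.map e.symm
  left_inv z := by
    induction z with
    | h x y => simp
  right_inv z := by
    induction z with
    | h x y => simp

/-- Transport of finite sets of pairs along an equivalence. -/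
def mapF {H K : Type} (e : H ≃ K) : Finset (Sym2 H) ≃ Finset (Sym2 K) :=
  Equiv.finsetCongr (symEquiv e)

theorem mapF_val {H K : Type} (e : H ≃ K) (m : Finset (Sym2 H)) :
    (mapF e m).val = m.val.map (Sym2.map e) := rfl

theorem mem_maxM_mapF {H K : Type} [Fintype H] [Fintype K] (e : H ≃ K) (m : Finset (Sym2 H)) :
    m ∈ maxM H ↔ mapF e m ∈ maxM K := by
  rw [mem_maxM, mem_maxM, mapF_val]
  refine ⟨fun h => h.map e, fun h => ?_⟩
  have := h.map e.symm
  rw [Multiset.map_map] at this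
  convert this using 1
  conv_lhs => rw [← Multiset.map_id m.val]
  refine Multiset.map_congr rfl (fun z _ => ?_)
  simp only [Function.comp, Sym2.map_map, id]
  rw [show (fun x => e.symm (e x)) = id from by funext x; simp]
  simp

/-! ### Graphs attached to labelled patterns and their group averages -/

/-- The multigraph on `V` obtained from a multiset of pairs of half-edges labelled by `V`. -/
def gr {V H : Type} [Fintype V] (ℓ : H → V) (E : Multiset (Sym2 H)) : Multigraph :=
  { V := V, edges := E.map (Sym2.map ℓ) }

theorem gr_map {V H K : Type} [Fintype V] (ℓ : K → V) (g : H → K) (E : Multiset (Sym2 H)) :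
    gr ℓ (E.map (Sym2.map g)) = gr (ℓ ∘ g) E := by
  unfold gr
  simp only [Multiset.map_map]
  congr 1
  refine Multiset.map_congr rfl (fun e _ => ?_)
  induction e with
  | h x y => simp

theorem gr_cons {V H : Type} [Fintype V] (ℓ : H → V) (x y : H) (E : Multiset (Sym2 H)) :
    gr ℓ (s(x, y) ::ₘ E) = (gr ℓ E).addEdge (ℓ x) (ℓ y) := by
  unfold gr Multigraph.addEdge
  simp

theorem kappa_nonneg {f : Multigraph → ℝ} {κ : ℝ} (hlip : GraphParam.Lipschitz f κ) : 0 ≤ κ :=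
  le_trans (abs_nonneg _) (hlip { V := Unit, edges := 0 } () ())

theorem lip_gr {f : Multigraph → ℝ} {κ : ℝ} (hlip : GraphParam.Lipschitz f κ)
    {V H : Type} [Fintype V] (ℓ : H → V) (e : Sym2 H) (E : Multiset (Sym2 H)) :
    |f (gr ℓ (e ::ₘ E)) - f (gr ℓ E)| ≤ κ := by
  induction e with
  | h x y => rw [gr_cons]; exact hlip _ _ _

theorem lip_gr_add {f : Multigraph → ℝ} {κ : ℝ} (hlip : GraphParam.Lipschitz f κ)
    {V H : Type} [Fintype V] (ℓ : H → V) (E R : Multiset (Sym2 H)) :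
    |f (gr ℓ (E + R)) - f (gr ℓ E)| ≤ κ * R.card := by
  induction R using Multiset.induction_on with
  | empty => simp
  | cons e R ih =>
    have h := lip_gr hlip ℓ e (E + R)
    rw [Multiset.add_cons]
    rw [abs_le] at *
    simp only [Multiset.card_cons]
    push_cast
    constructor <;> nlinarith [h.1, h.2, ih.1, ih.2]

/-- Colour preserving permutations. -/
def colG {H C : Type} (χ : H → C) : Subgroup (Equiv.Perm H) where
  carrier := {σ | ∀ h, χ (σ h) = χ h}
  mul_mem' := by
    intro a b ha hb h
    simp only [Set.mem_ofPred_eq] at ha hb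
    rw [Equiv.Perm.mul_apply, ha, hb]
  one_mem' := by intro h; rfl
  inv_mem' := by
    intro a ha h
    simp only [Set.mem_ofPred_eq] at ha
    rw [← ha (a⁻¹ h)]
    simp

/-- Average of `f` over all colour preserving relabellings of a pattern. -/
noncomputable def Phi {V H C : Type} [Fintype V] [Fintype H] (f : Multigraph → ℝ) (ℓ : H → V)
    (χ : H → C) (E : Multiset (Sym2 H)) : ℝ :=
  𝔼 σ : colG χ, f (gr (ℓ ∘ (σ : Equiv.Perm H)) E)

section
variable {V H C : Type} [Fintype V] [Fintype H] {f : Multigraph → ℝ} {κ : ℝ}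

theorem Phi_add_lip (hlip : GraphParam.Lipschitz f κ) (ℓ : H → V) (χ : H → C)
    (E R : Multiset (Sym2 H)) : |Phi f ℓ χ (E + R) - Phi f ℓ χ E| ≤ κ * R.card := by
  unfold Phi
  rw [← Finset.expect_sub_distrib]
  refine le_trans (Finset.abs_expect_le _ _) ?_
  exact Finset.expect_le Finset.univ_nonempty (fun σ _ => lip_gr_add hlip _ _ _)

theorem Phi_cons_lip (hlip : GraphParam.Lipschitz f κ) (ℓ : H → V) (χ : H → C)
    (e : Sym2 H) (E : Multiset (Sym2 H)) : |Phi f ℓ χ (e ::ₘ E) - Phi f ℓ χ E| ≤ κ := by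
  have := Phi_add_lip hlip ℓ χ E {e}
  rw [add_comm, Multiset.singleton_add] at this
  simpa using this

theorem Phi_le_lip (hlip : GraphParam.Lipschitz f κ) (ℓ : H → V) (χ : H → C)
    {E E' : Multiset (Sym2 H)} (h : E ≤ E') :
    |Phi f ℓ χ E' - Phi f ℓ χ E| ≤ κ * ((E'.card : ℝ) - E.card) := by
  obtain ⟨R, rfl⟩ := Multiset.le_iff_exists_add.1 h
  have := Phi_add_lip hlip ℓ χ E R
  simpa using this

theorem Phi_map (ℓ : H → V) (χ : H → C) (E : Multiset (Sym2 H)) (τ : Equiv.Perm H)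
    (hτ : ∀ h, χ (τ h) = χ h) : Phi f ℓ χ (E.map (Sym2.map τ)) = Phi f ℓ χ E := by
  unfold Phi
  refine Fintype.expect_equiv (Equiv.mulRight (⟨τ, hτ⟩ : colG χ)) _ _ (fun σ => ?_)
  rw [gr_map]
  rfl

theorem Phi_congr (ℓ : H → V) (χ : H → C) {E E' : Multiset (Sym2 H)} (hE : IsM E) (hE' : IsM E')
    (h : E.map (Sym2.map χ) = E'.map (Sym2.map χ)) : Phi f ℓ χ E = Phi f ℓ χ E' := by
  obtain ⟨σ, hσ, hle⟩ := exists_perm_le χ hE hE' h.le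
  have : E.map (Sym2.map σ) = E' := by
    refine Multiset.eq_of_le_of_card_le hle ?_
    have := congrArg Multiset.card h
    simp at this ⊢
    omega
  rw [← Phi_map ℓ χ E σ hσ, this]

theorem gr_concave (hconc : GraphParam.Concave f) (ℓ : H → V) (E : Multiset (Sym2 H))
    (w : H → ℝ) (hw : ∑ h, w h = 0) :
    ∑ h, ∑ h', f (gr ℓ (s(h, h') ::ₘ E)) * w h * w h' ≤ 0 := by
  have key := hconc (gr ℓ E) (fun i => ∑ h, if ℓ h = i then w h else 0) (by
    rw [Finset.sum_comm]
    calc _ = ∑ h, w h := by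
          refine Finset.sum_congr rfl (fun h _ => ?_)
          exact (Finset.sum_ite_eq _ _ _).trans (if_pos (Finset.mem_univ _))
      _ = 0 := hw)
  have e1 : ∀ g : V → V → ℝ,
      ∑ i, ∑ j, g i j * (∑ h, if ℓ h = i then w h else 0) * (∑ h, if ℓ h = j then w h else 0)
        = ∑ h, ∑ h', g (ℓ h) (ℓ h') * w h * w h' := by
    intro g
    simp_rw [Finset.mul_sum, Finset.sum_mul]
    calc _ = ∑ i, ∑ h', ∑ h, ∑ j, (g i j * (if ℓ h = i then w h else 0) *
          (if ℓ h' = j then w h' else 0)) := by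
          refine Finset.sum_congr rfl (fun i _ => ?_)
          rw [Finset.sum_comm]
          refine Finset.sum_congr rfl (fun h' _ => ?_)
          rw [Finset.sum_comm]
      _ = ∑ i, ∑ h', ∑ h, (g i (ℓ h') * (if ℓ h = i then w h else 0) * w h') := by
          refine Finset.sum_congr rfl (fun i _ => Finset.sum_congr rfl (fun h' _ =>
            Finset.sum_congr rfl (fun h _ => ?_)))
          simp
      _ = ∑ h', ∑ h, ∑ i, (g i (ℓ h') * (if ℓ h = i then w h else 0) * w h') := by
          rw [Finset.sum_comm]
          refine Finset.sum_congr rfl (fun h' _ => ?_)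
          rw [Finset.sum_comm]
      _ = ∑ h', ∑ h, (g (ℓ h) (ℓ h') * w h * w h') := by
          refine Finset.sum_congr rfl (fun i _ => Finset.sum_congr rfl (fun h' _ => ?_))
          simp
      _ = _ := Finset.sum_comm
  have key2 := (e1 (fun i j => f ((gr ℓ E).addEdge i j) - f (gr ℓ E))).symm.trans_le key
  have e2 : ∑ h, ∑ h', f (gr ℓ E) * w h * w h' = 0 := by
    simp_rw [← Finset.mul_sum, hw]; simp
  have e3 : ∑ h, ∑ h', f (gr ℓ (s(h, h') ::ₘ E)) * w h * w h' =
      ∑ h, ∑ h', (f ((gr ℓ E).addEdge (ℓ h) (ℓ h')) - f (gr ℓ E)) * w h * w h'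
        + ∑ h, ∑ h', f (gr ℓ E) * w h * w h' := by
    rw [← Finset.sum_add_distrib]
    refine Finset.sum_congr rfl (fun h _ => ?_)
    rw [← Finset.sum_add_distrib]
    refine Finset.sum_congr rfl (fun h' _ => ?_)
    rw [gr_cons]; ring
  rw [e3, e2, add_zero]
  exact key2

theorem sum_ind (A B : Finset H) (Q : H → H → ℝ) :
    ∑ h, ∑ h', Q h h' * (if h ∈ A then (A.card : ℝ)⁻¹ else 0) *
      (if h' ∈ B then (B.card : ℝ)⁻¹ else 0) = 𝔼 h ∈ A, 𝔼 h' ∈ B, Q h h' := by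
  simp only [Finset.expect_eq_sum_div_card]
  have : ∀ h, ∑ h', Q h h' * (if h ∈ A then (A.card : ℝ)⁻¹ else 0) *
      (if h' ∈ B then (B.card : ℝ)⁻¹ else 0) =
      if h ∈ A then ((∑ h' ∈ B, Q h h') / B.card) / A.card else 0 := by
    intro h
    split_ifs with hA
    · simp only [mul_ite, mul_zero, Finset.sum_ite_mem, Finset.univ_inter]
      rw [Finset.sum_div, Finset.sum_div]
      refine Finset.sum_congr rfl (fun h' _ => ?_)
      simp only [div_eq_mul_inv]; ring
    · simp
  simp_rw [this]
  rw [Finset.sum_ite_mem, Finset.univ_inter, Finset.sum_div]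

theorem gr_concave_AB (hconc : GraphParam.Concave f) (ℓ : H → V) (E : Multiset (Sym2 H))
    (A B : Finset H) (hA : A.Nonempty) (hB : B.Nonempty) :
    (𝔼 h ∈ A, 𝔼 h' ∈ A, f (gr ℓ (s(h, h') ::ₘ E)))
      + (𝔼 h ∈ B, 𝔼 h' ∈ B, f (gr ℓ (s(h, h') ::ₘ E)))
      ≤ 2 * 𝔼 h ∈ A, 𝔼 h' ∈ B, f (gr ℓ (s(h, h') ::ₘ E)) := by
  have ha : (A.card : ℝ) ≠ 0 := by simpa using hA.ne_empty
  have hb : (B.card : ℝ) ≠ 0 := by simpa using hB.ne_empty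
  have key := gr_concave hconc ℓ E
    (fun h => (if h ∈ A then (A.card : ℝ)⁻¹ else 0) - (if h ∈ B then (B.card : ℝ)⁻¹ else 0)) (by
      rw [Finset.sum_sub_distrib, Finset.sum_ite_mem, Finset.sum_ite_mem]
      simp [ha, hb])
  have hsym : (𝔼 h ∈ B, 𝔼 h' ∈ A, f (gr ℓ (s(h, h') ::ₘ E))) =
      𝔼 h ∈ A, 𝔼 h' ∈ B, f (gr ℓ (s(h, h') ::ₘ E)) := by
    rw [Finset.expect_comm]
    refine Finset.expect_congr rfl (fun h _ => Finset.expect_congr rfl (fun h' _ => ?_))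
    rw [Sym2.eq_swap]
  have e : ∀ a b c d q : ℝ, q * (a - b) * (c - d) = q * a * c - q * a * d - q * b * c + q * b * d := by
    intros; ring
  simp only [e, Finset.sum_add_distrib, Finset.sum_sub_distrib, sum_ind] at key
  rw [hsym] at key
  linarith

theorem Phi_concave (hconc : GraphParam.Concave f) (ℓ : H → V) (χ : H → C) (E : Multiset (Sym2 H))
    (A B : Finset H) (hA : A.Nonempty) (hB : B.Nonempty) :
    (𝔼 h ∈ A, 𝔼 h' ∈ A, Phi f ℓ χ (s(h, h') ::ₘ E))
      + (𝔼 h ∈ B, 𝔼 h' ∈ B, Phi f ℓ χ (s(h, h') ::ₘ E))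
      ≤ 2 * 𝔼 h ∈ A, 𝔼 h' ∈ B, Phi f ℓ χ (s(h, h') ::ₘ E) := by
  have e : ∀ A B : Finset H, (𝔼 h ∈ A, 𝔼 h' ∈ B, Phi f ℓ χ (s(h, h') ::ₘ E)) =
      𝔼 σ : colG χ, 𝔼 h ∈ A, 𝔼 h' ∈ B, f (gr (ℓ ∘ (σ : Equiv.Perm H)) (s(h, h') ::ₘ E)) := by
    intro A B
    unfold Phi
    rw [Finset.expect_comm (s := Finset.univ)]
    refine Finset.expect_congr rfl (fun h _ => ?_)
    rw [Finset.expect_comm]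
  rw [e, e, e, ← Finset.expect_add_distrib, Finset.mul_expect]
  exact Finset.expect_le_expect (fun σ _ => gr_concave_AB hconc _ E A B hA hB)

end

/-! ### The interpolation argument -/

/-- Number of bichromatic edges. -/
noncomputable def crossN {H : Type} (χ : H → Bool) (E : Multiset (Sym2 H)) : ℕ :=
  (E.map (Sym2.map χ)).count s(true, false)

/-- Free half-edges of a given colour. -/
noncomputable def frS {H : Type} [Fintype H] (χ : H → Bool) (E : Multiset (Sym2 H)) (b : Bool) :
    Finset H := Finset.univ.filter fun h => χ h = b ∧ h ∉ endp E

section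
variable {V H : Type} [Fintype V] [Fintype H] {f : Multigraph → ℝ} {κ : ℝ}

theorem mem_frS {χ : H → Bool} {E : Multiset (Sym2 H)} {b : Bool} {h : H} :
    h ∈ frS χ E b ↔ χ h = b ∧ h ∉ endp E := by simp [frS]

theorem frS_cons (χ : H → Bool) (E : Multiset (Sym2 H)) (b : Bool) (x y : H) :
    frS χ (s(x, y) ::ₘ E) b = ((frS χ E b).erase x).erase y := by
  ext h
  simp only [mem_frS, Finset.mem_erase, endp_cons, toMultiset_mk, Multiset.mem_add,
    Multiset.insert_eq_cons, Multiset.mem_cons, Multiset.mem_singleton]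
  tauto

theorem crossN_cons (χ : H → Bool) (E : Multiset (Sym2 H)) (x y : H) :
    crossN χ (s(x, y) ::ₘ E) = crossN χ E + if χ x = χ y then 0 else 1 := by
  unfold crossN
  rw [Multiset.map_cons, Multiset.count_cons]
  congr 1
  simp only [Sym2.map_mk, Sym2.eq_iff]
  cases χ x <;> cases χ y <;> simp

theorem exists_cross {χ : H → Bool} {E : Multiset (Sym2 H)} (h : 0 < crossN χ E) :
    ∃ x y E', E = s(x, y) ::ₘ E' ∧ χ x = true ∧ χ y = false := by
  unfold crossN at h
  rw [Multiset.count_pos] at h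
  obtain ⟨e, he, hee⟩ := Multiset.mem_map.1 h
  obtain ⟨E', rfl⟩ := Multiset.exists_cons_of_mem he
  induction e with
  | h a b =>
    simp only [Sym2.map_mk, Sym2.eq_iff] at hee
    rcases hee with ⟨h1, h2⟩ | ⟨h1, h2⟩
    · exact ⟨a, b, E', rfl, h1, h2⟩
    · exact ⟨b, a, E', by rw [Sym2.eq_swap], h2, h1⟩

theorem remove_cross {χ : H → Bool} (k : ℕ) : ∀ {E : Multiset (Sym2 H)}, IsM E → k ≤ crossN χ E →
    ∃ E' ≤ E, E'.card + k = E.card ∧ crossN χ E' + k = crossN χ E ∧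
      ∀ b, (frS χ E' b).card = (frS χ E b).card + k := by
  induction k with
  | zero => intro E _ _; exact ⟨E, le_rfl, by simp⟩
  | succ k ih =>
    intro E hE hk
    obtain ⟨E1, hle, h1, h2, h3⟩ := ih hE (by omega)
    obtain ⟨x, y, E', rfl, hx, hy⟩ := exists_cross (χ := χ) (E := E1) (by omega)
    have hM := hE.mono hle
    rw [isM_cons] at hM
    rw [crossN_cons] at h2
    simp only [hx, hy, Bool.true_eq_false, if_false] at h2
    refine ⟨E', le_trans (Multiset.le_cons_self _ _) hle, ?_, by omega, fun b => ?_⟩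
    · simp at h1; omega
    · have h4 := h3 b
      rw [frS_cons] at h4
      cases b
      · rw [Finset.erase_eq_of_notMem (a := x) (by simp [mem_frS, hx])] at h4
        have : y ∈ frS χ E' false := mem_frS.2 ⟨hy, hM.2.2.1⟩
        have := Finset.card_erase_add_one this
        omega
      · rw [Finset.erase_eq_of_notMem (a := y) (by simp [mem_frS, hy])] at h4
        have : x ∈ frS χ E' true := mem_frS.2 ⟨hx, hM.2.1⟩
        have := Finset.card_erase_add_one this
        omega

/-- The monochromatic case. -/
theorem interp_base (hlip : GraphParam.Lipschitz f κ) (ℓ : H → V) (χ : H → Bool)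
    {S : Multiset (Sym2 H)} (hS : IsM S)
    (hSmax : ∀ E, IsM E → crossN χ E = 0 → E.map (Sym2.map χ) ≤ S.map (Sym2.map χ))
    {E : Multiset (Sym2 H)} (hE : IsM E) (hc : crossN χ E = 0) :
    Phi f ℓ χ S - κ * ((S.card : ℝ) - E.card) ≤ Phi f ℓ χ E := by
  obtain ⟨σ, hσ, hle⟩ := exists_perm_le χ hE hS (hSmax E hE hc)
  have h := Phi_le_lip hlip ℓ χ hle
  rw [Phi_map ℓ χ E σ hσ, Multiset.card_map] at h
  have := (abs_le.1 h).2
  linarith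

theorem interp_triv (hlip : GraphParam.Lipschitz f κ) (ℓ : H → V) (χ : H → Bool)
    {S : Multiset (Sym2 H)} (hS : IsM S)
    (hSmax : ∀ E, IsM E → crossN χ E = 0 → E.map (Sym2.map χ) ≤ S.map (Sym2.map χ))
    {E : Multiset (Sym2 H)} (hE : IsM E) :
    Phi f ℓ χ S - κ * ((S.card : ℝ) - E.card) - 2 * κ * crossN χ E ≤ Phi f ℓ χ E := by
  obtain ⟨E', hle, h1, h2, -⟩ := remove_cross (χ := χ) (crossN χ E) hE le_rfl
  have hb := interp_base hlip ℓ χ hS hSmax (hE.mono hle) (by omega)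
  have h := (abs_le.1 (Phi_le_lip hlip ℓ χ hle)).1
  have h3 : (E.card : ℝ) = E'.card + crossN χ E := by exact_mod_cast h1.symm
  rw [h3] at h ⊢
  nlinarith

theorem interp_avg (hlip : GraphParam.Lipschitz f κ) (ℓ : H → V) (χ : H → Bool)
    (E : Multiset (Sym2 H)) (A : Finset H) (hA : 2 ≤ A.card) (X : ℝ)
    (hX : ∀ x ∈ A, ∀ y ∈ A, x ≠ y → X ≤ Phi f ℓ χ (s(x, y) ::ₘ E)) :
    X - 2 * κ / A.card ≤ 𝔼 x ∈ A, 𝔼 y ∈ A, Phi f ℓ χ (s(x, y) ::ₘ E) := by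
  have hne : A.Nonempty := Finset.card_pos.1 (by omega)
  refine Finset.le_expect hne (fun x hx => ?_)
  have : X - 2 * κ / A.card = 𝔼 y ∈ A, (X - if x = y then 2 * κ else 0) := by
    rw [Finset.expect_sub_distrib, Finset.expect_const hne, Finset.expect_eq_sum_div_card,
      Finset.sum_ite_eq, if_pos hx]
  rw [this]
  refine Finset.expect_le_expect (fun y hy => ?_)
  split_ifs with hxy
  · subst hxy
    obtain ⟨z, hz, hzx⟩ := Finset.exists_mem_ne (by omega : 1 < A.card) x
    have h1 := hX x hx z hz hzx.symm
    have h2 := (abs_le.1 (Phi_cons_lip hlip ℓ χ s(x, z) E)).2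
    have h3 := (abs_le.1 (Phi_cons_lip hlip ℓ χ s(x, x) E)).1
    linarith
  · have := hX x hx y hy hxy
    linarith

theorem interp_step (hlip : GraphParam.Lipschitz f κ) (hconc : GraphParam.Concave f)
    (ℓ : H → V) (χ : H → Bool)
    {S : Multiset (Sym2 H)} (hS : IsM S)
    (hSmax : ∀ E, IsM E → crossN χ E = 0 → E.map (Sym2.map χ) ≤ S.map (Sym2.map χ))
    (R c0 : ℕ) (hR : 2 ≤ R) (α β : ℝ) (hα : α = 32 * κ * c0 / (R : ℝ) ^ 2)
    (hβ : β = α + 8 * κ / R) (c : ℕ) : c ≤ c0 →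
    ∀ E : Multiset (Sym2 H), IsM E → crossN χ E = c →
      (frS χ E true).card + (frS χ E false).card = R →
      Phi f ℓ χ S - κ * ((S.card : ℝ) - E.card)
        - α * ((((frS χ E true).card : ℝ) - (frS χ E false).card) / 2) ^ 2 - β * c
        ≤ Phi f ℓ χ E := by
  have hκ := kappa_nonneg hlip
  have hR0 : (0 : ℝ) < R := by exact_mod_cast (by omega : 0 < R)
  have hα0 : 0 ≤ α := by rw [hα]; positivity
  have hβ0 : 0 ≤ β := by rw [hβ]; positivity
  induction c with
  | zero =>
    intro _ E hE hc _
    have h := interp_base hlip ℓ χ hS hSmax hE hc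
    have : 0 ≤ α * ((((frS χ E true).card : ℝ) - (frS χ E false).card) / 2) ^ 2 := by positivity
    simp only [Nat.cast_zero, mul_zero, sub_zero]
    linarith
  | succ c ih =>
    intro hc0 E hE hc hfr
    set r1 := (frS χ E true).card with hr1
    set r2 := (frS χ E false).card with hr2
    have hRr : (R : ℝ) = r1 + r2 := by exact_mod_cast hfr.symm
    set v : ℝ := ((r1 : ℝ) - r2) / 2 with hv
    by_cases hbig : (R : ℝ) / 4 ≤ |v|
    · have h := interp_triv hlip ℓ χ hS hSmax hE
      have hv2 : (R : ℝ) ^ 2 / 16 ≤ v ^ 2 := by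
        rw [← sq_abs v]
        nlinarith [abs_nonneg v]
      have h2 : 2 * κ * c0 ≤ α * v ^ 2 := by
        calc 2 * κ * c0 = α * ((R : ℝ) ^ 2 / 16) := by
              rw [hα]; field_simp; ring
          _ ≤ α * v ^ 2 := mul_le_mul_of_nonneg_left hv2 hα0
      have h3 : 2 * κ * (crossN χ E : ℝ) ≤ 2 * κ * c0 := by
        have : (crossN χ E : ℝ) ≤ c0 := by exact_mod_cast (by omega : crossN χ E ≤ c0)
        exact mul_le_mul_of_nonneg_left this (by positivity)
      have h4 : 0 ≤ β * ((c + 1 : ℕ) : ℝ) := by positivity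
      linarith
    · push Not at hbig
      rw [abs_lt] at hbig
      obtain ⟨x, y, E', rfl, hx, hy⟩ := exists_cross (χ := χ) (E := E) (by omega)
      have hM := hE
      rw [isM_cons] at hM
      obtain ⟨hxy, hxE, hyE, hE'⟩ := hM
      rw [crossN_cons] at hc
      simp only [hx, hy, Bool.true_eq_false, if_false] at hc
      set A := frS χ E' true with hA
      set B := frS χ E' false with hB
      have hxA : x ∈ A := mem_frS.2 ⟨hx, hxE⟩
      have hyB : y ∈ B := mem_frS.2 ⟨hy, hyE⟩
      have hAc : A.card = r1 + 1 := by
        rw [hr1, frS_cons, Finset.erase_eq_of_notMem (a := y) (by simp [mem_frS, hy]),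
          ← hA, Finset.card_erase_add_one hxA]
      have hBc : B.card = r2 + 1 := by
        rw [hr2, frS_cons, Finset.erase_eq_of_notMem (a := x) (by simp [mem_frS, hx]),
          ← hB, Finset.card_erase_add_one hyB]
      have hr1pos : (R : ℝ) / 4 < r1 := by rw [hv] at hbig; linarith [hbig.1]
      have hr2pos : (R : ℝ) / 4 < r2 := by rw [hv] at hbig; linarith [hbig.2]
      have hr1' : 1 ≤ r1 := by
        have : (0 : ℝ) < r1 := by linarith
        exact_mod_cast this
      have hr2' : 1 ≤ r2 := by
        have : (0 : ℝ) < r2 := by linarith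
        exact_mod_cast this
      set L := Phi f ℓ χ S - κ * ((S.card : ℝ) - (s(x, y) ::ₘ E').card) with hL
      have hXA := interp_avg hlip ℓ χ E' A (by omega) (L - α * (v - 1) ^ 2 - β * c) (by
        intro x1 hx1 x2 hx2 hne
        rw [hA, mem_frS] at hx1 hx2
        have h := ih (by omega) (s(x1, x2) ::ₘ E') (isM_cons.2 ⟨hne, hx1.2, hx2.2, hE'⟩)
          (by rw [crossN_cons, hx1.1, hx2.1]; simpa using hc)
        have c1 : (frS χ (s(x1, x2) ::ₘ E') true).card + 1 = r1 := by
          have h1 : x2 ∈ A.erase x1 := Finset.mem_erase.2 ⟨hne.symm, mem_frS.2 hx2⟩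
          have h2 := Finset.card_erase_add_one h1
          have h3 : (A.erase x1).card + 1 = A.card := Finset.card_erase_add_one (mem_frS.2 hx1)
          rw [frS_cons, ← hA]
          omega
        have c2 : (frS χ (s(x1, x2) ::ₘ E') false).card = r2 + 1 := by
          rw [frS_cons, Finset.erase_eq_of_notMem (a := x1) (by simp [mem_frS, hx1.1]),
            Finset.erase_eq_of_notMem (a := x2) (by simp [mem_frS, hx2.1]), ← hB, hBc]
        have h := h (by omega)
        have c1' : ((frS χ (s(x1, x2) ::ₘ E') true).card : ℝ) = r1 - 1 := by
          rw [← c1]; push_cast; ring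
        rw [c2, c1'] at h
        convert h using 3
        · rw [hL]; simp
        · rw [hv]; push_cast; ring)
      have hXB := interp_avg hlip ℓ χ E' B (by omega) (L - α * (v + 1) ^ 2 - β * c) (by
        intro x1 hx1 x2 hx2 hne
        rw [hB, mem_frS] at hx1 hx2
        have h := ih (by omega) (s(x1, x2) ::ₘ E') (isM_cons.2 ⟨hne, hx1.2, hx2.2, hE'⟩)
          (by rw [crossN_cons, hx1.1, hx2.1]; simpa using hc)
        have c1 : (frS χ (s(x1, x2) ::ₘ E') false).card + 1 = r2 := by
          have h1 : x2 ∈ B.erase x1 := Finset.mem_erase.2 ⟨hne.symm, mem_frS.2 hx2⟩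
          have h2 := Finset.card_erase_add_one h1
          have h3 : (B.erase x1).card + 1 = B.card := Finset.card_erase_add_one (mem_frS.2 hx1)
          rw [frS_cons, ← hB]
          omega
        have c2 : (frS χ (s(x1, x2) ::ₘ E') true).card = r1 + 1 := by
          rw [frS_cons, Finset.erase_eq_of_notMem (a := x1) (by simp [mem_frS, hx1.1]),
            Finset.erase_eq_of_notMem (a := x2) (by simp [mem_frS, hx2.1]), ← hA, hAc]
        have h := h (by omega)
        have c1' : ((frS χ (s(x1, x2) ::ₘ E') false).card : ℝ) = r2 - 1 := by
          rw [← c1]; push_cast; ring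
        rw [c2, c1'] at h
        convert h using 3
        · rw [hL]; simp
        · rw [hv]; push_cast; ring)
      have hcr : (𝔼 h ∈ A, 𝔼 h' ∈ B, Phi f ℓ χ (s(h, h') ::ₘ E')) = Phi f ℓ χ (s(x, y) ::ₘ E') := by
        rw [Finset.expect_congr rfl (g := fun _ => Phi f ℓ χ (s(x, y) ::ₘ E')),
          Finset.expect_const ⟨x, hxA⟩]
        intro h hh
        rw [Finset.expect_congr rfl (g := fun _ => Phi f ℓ χ (s(x, y) ::ₘ E')),
          Finset.expect_const ⟨y, hyB⟩]
        intro h' hh'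
        rw [hA, mem_frS] at hh
        rw [hB, mem_frS] at hh'
        refine Phi_congr ℓ χ (isM_cons.2 ⟨?_, hh.2, hh'.2, hE'⟩) hE ?_
        · rintro rfl
          rw [hh.1] at hh'
          exact absurd hh'.1 (by simp)
        · simp [hh.1, hh'.1, hx, hy]
      have hconv := Phi_concave (f := f) hconc ℓ χ E' A B ⟨x, hxA⟩ ⟨y, hyB⟩
      rw [hcr] at hconv
      have hea : 2 * κ / (A.card : ℝ) ≤ 8 * κ / R := by
        rw [div_le_div_iff₀ (by rw [hAc]; positivity) hR0, hAc]
        push_cast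
        nlinarith
      have heb : 2 * κ / (B.card : ℝ) ≤ 8 * κ / R := by
        rw [div_le_div_iff₀ (by rw [hBc]; positivity) hR0, hBc]
        push_cast
        nlinarith
      push_cast
      have : β * (c + 1 : ℝ) = β * c + α + 8 * κ / R := by rw [mul_add, hβ]; ring
      rw [this]
      nlinarith

theorem free_le_one {χ : H → Bool} {E : Multiset (Sym2 H)} (hE : IsMxm E) :
    (frS χ E true).card + (frS χ E false).card ≤ 1 := by
  have hdisj : Disjoint (frS χ E true) (frS χ E false) := by
    rw [Finset.disjoint_left]
    intro h h1 h2
    rw [mem_frS] at h1 h2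
    rw [h1.1] at h2
    exact absurd h2.1 (by simp)
  rw [← Finset.card_union_of_disjoint hdisj]
  by_contra hlt
  push Not at hlt
  obtain ⟨x, hx, y, hy, hxy⟩ := Finset.one_lt_card.1 hlt
  have hfree : ∀ z ∈ frS χ E true ∪ frS χ E false, z ∉ endp E := by
    intro z hz
    rcases Finset.mem_union.1 hz with h | h
    · exact (mem_frS.1 h).2
    · exact (mem_frS.1 h).2
  have := hE.2 (s(x, y) ::ₘ E) (isM_cons.2 ⟨hxy, hfree x hx, hfree y hy, hE.1⟩)
  simp at this

theorem interp_k (hlip : GraphParam.Lipschitz f κ) (hconc : GraphParam.Concave f)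
    (ℓ : H → V) (χ : H → Bool)
    {S : Multiset (Sym2 H)} (hS : IsM S)
    (hSmax : ∀ E, IsM E → crossN χ E = 0 → E.map (Sym2.map χ) ≤ S.map (Sym2.map χ))
    {E : Multiset (Sym2 H)} (hE : IsMxm E) (k : ℕ) (hk : 1 ≤ k) (hkc : k ≤ crossN χ E) :
    Phi f ℓ χ S - κ * (2 * k + 10 * (crossN χ E : ℝ) ^ 2 / (k : ℝ) ^ 2 + 4 * (crossN χ E : ℝ) / k)
      ≤ Phi f ℓ χ E := by
  have hκ := kappa_nonneg hlip
  obtain ⟨E', hle, h1, h2, h3⟩ := remove_cross (χ := χ) k hE.1 hkc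
  have hf1 := free_le_one (χ := χ) hE
  set c := crossN χ E with hc
  set R := (frS χ E' true).card + (frS χ E' false).card with hR
  have hRk : 2 * k ≤ R := by rw [hR, h3, h3]; omega
  have hst := interp_step hlip hconc ℓ χ hS hSmax R c (by omega) _ _ rfl rfl (crossN χ E')
    (by omega) E' (hE.1.mono hle) rfl rfl
  have hl := (abs_le.1 (Phi_le_lip hlip ℓ χ hle)).1
  have h1' : (E.card : ℝ) = E'.card + k := by exact_mod_cast h1.symm
  have hSE : (S.card : ℝ) ≤ E.card := by exact_mod_cast hE.2 S hS
  have hk0 : (1 : ℝ) ≤ k := by exact_mod_cast hk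
  have hc0 : (1 : ℝ) ≤ c := by exact_mod_cast le_trans hk hkc
  have hRk' : 2 * (k : ℝ) ≤ R := by exact_mod_cast hRk
  have hR0 : (0 : ℝ) < R := by linarith
  have hα : 32 * κ * c / (R : ℝ) ^ 2 ≤ 8 * κ * c / (k : ℝ) ^ 2 := by
    rw [div_le_div_iff₀ (pow_pos hR0 2) (by positivity)]
    have : 4 * (k : ℝ) ^ 2 ≤ (R : ℝ) ^ 2 := by nlinarith
    have h0 : 0 ≤ κ * c := by positivity
    nlinarith
  have hα0 : 0 ≤ 32 * κ * c / (R : ℝ) ^ 2 := by positivity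
  have hv : ((((frS χ E' true).card : ℝ) - (frS χ E' false).card) / 2) ^ 2 ≤ 1 / 4 := by
    rw [h3, h3]
    push_cast
    have ha : (0 : ℝ) ≤ (frS χ E true).card := by positivity
    have hb : (0 : ℝ) ≤ (frS χ E false).card := by positivity
    have hab : ((frS χ E true).card : ℝ) + (frS χ E false).card ≤ 1 := by exact_mod_cast hf1
    nlinarith
  have hβ : 8 * κ / (R : ℝ) ≤ 4 * κ / k := by
    rw [div_le_div_iff₀ hR0 (by positivity)]
    nlinarith
  have hcc : ((crossN χ E' : ℕ) : ℝ) ≤ c := by exact_mod_cast (by omega : crossN χ E' ≤ c)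
  have t1 : 32 * κ * c / (R : ℝ) ^ 2 *
      ((((frS χ E' true).card : ℝ) - (frS χ E' false).card) / 2) ^ 2 ≤
      8 * κ * c / (k : ℝ) ^ 2 * (1 / 4) :=
    mul_le_mul hα hv (by positivity) (by positivity)
  have t2 : (32 * κ * c / (R : ℝ) ^ 2 + 8 * κ / R) * (crossN χ E' : ℝ) ≤
      (8 * κ * c / (k : ℝ) ^ 2 + 4 * κ / k) * c :=
    mul_le_mul (add_le_add hα hβ) hcc (by positivity) (by positivity)
  have t3 : 8 * κ * c / (k : ℝ) ^ 2 * (1 / 4) ≤ 2 * κ * (c : ℝ) ^ 2 / (k : ℝ) ^ 2 := by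
    rw [div_mul_eq_mul_div, div_le_div_iff_of_pos_right (by positivity)]
    have : κ * c * 1 ≤ κ * c * c := mul_le_mul_of_nonneg_left hc0 (by positivity)
    nlinarith
  have t4 : κ * ((S.card : ℝ) - E'.card) ≤ κ * k := by
    refine mul_le_mul_of_nonneg_left (by linarith) hκ
  rw [h1'] at hl
  have t5 : κ * (2 * k + 10 * (c : ℝ) ^ 2 / (k : ℝ) ^ 2 + 4 * (c : ℝ) / k) =
      κ * k + κ * k + 2 * κ * (c : ℝ) ^ 2 / (k : ℝ) ^ 2 + (8 * κ * c / (k : ℝ) ^ 2 + 4 * κ / k) * c := by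
    field_simp; ring
  rw [t5]
  have t6 : κ * ((E'.card : ℝ) + k - E'.card) = κ * k := by ring
  rw [t6] at hl
  linarith

theorem interp_max (hlip : GraphParam.Lipschitz f κ) (hconc : GraphParam.Concave f)
    (ℓ : H → V) (χ : H → Bool)
    {S : Multiset (Sym2 H)} (hS : IsM S)
    (hSmax : ∀ E, IsM E → crossN χ E = 0 → E.map (Sym2.map χ) ≤ S.map (Sym2.map χ))
    {E : Multiset (Sym2 H)} (hE : IsMxm E) :
    Phi f ℓ χ S - 18 * κ * (crossN χ E : ℝ) ^ (2 / 3 : ℝ) ≤ Phi f ℓ χ E := by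
  have hκ := kappa_nonneg hlip
  rcases Nat.eq_zero_or_pos (crossN χ E) with hc | hc
  · have h := interp_base hlip ℓ χ hS hSmax hE.1 hc
    have hSE : (S.card : ℝ) ≤ E.card := by exact_mod_cast hE.2 S hS
    rw [hc]
    have : ((0 : ℕ) : ℝ) ^ (2 / 3 : ℝ) = 0 := by
      rw [Nat.cast_zero]; exact Real.zero_rpow (by norm_num)
    rw [this]
    nlinarith
  · set c := crossN χ E with hcdef
    have hc1 : (1 : ℝ) ≤ c := by exact_mod_cast hc
    set t : ℝ := (c : ℝ) ^ (2 / 3 : ℝ) with ht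
    have ht1 : 1 ≤ t := Real.one_le_rpow hc1 (by norm_num)
    have htc : t ≤ c := by
      calc t ≤ (c : ℝ) ^ (1 : ℝ) := Real.rpow_le_rpow_of_exponent_le hc1 (by norm_num)
        _ = c := Real.rpow_one _
    have ht3 : t ^ 3 = (c : ℝ) ^ 2 := by
      rw [ht, ← Real.rpow_natCast, ← Real.rpow_mul (by positivity)]
      norm_num
    have hk1 : 1 ≤ ⌈t⌉₊ := Nat.one_le_ceil_iff.2 (by linarith)
    have hkc : ⌈t⌉₊ ≤ c := Nat.ceil_le.2 htc
    have h := interp_k hlip hconc ℓ χ hS hSmax hE ⌈t⌉₊ hk1 hkc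
    rw [← hcdef] at h
    set k : ℝ := (⌈t⌉₊ : ℝ) with hk
    have hkt : t ≤ k := Nat.le_ceil t
    have hkt2 : k ≤ 2 * t := by
      have := Nat.ceil_lt_add_one (show 0 ≤ t by linarith)
      linarith
    have e1 : 10 * (c : ℝ) ^ 2 / k ^ 2 ≤ 10 * t := by
      rw [div_le_iff₀ (by positivity), ← ht3]
      have : t ^ 2 ≤ k ^ 2 := by nlinarith
      nlinarith
    have hct : (c : ℝ) ≤ t ^ 2 := by
      by_contra hlt
      push Not at hlt
      have : t ^ 2 * t ^ 2 < (c : ℝ) * c := by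
        apply mul_lt_mul'' hlt hlt <;> positivity
      nlinarith [pow_pos (show 0 < t by linarith) 3]
    have e2 : 4 * (c : ℝ) / k ≤ 4 * t := by
      rw [div_le_iff₀ (by linarith)]
      nlinarith
    have : κ * (2 * k + 10 * (c : ℝ) ^ 2 / k ^ 2 + 4 * (c : ℝ) / k) ≤ κ * (18 * t) :=
      mul_le_mul_of_nonneg_left (by linarith) hκ
    linarith

theorem crossN_le {χ : H → Bool} {E : Multiset (Sym2 H)} (hE : IsM E) (b : Bool) :
    crossN χ E ≤ (Finset.univ.filter fun h => χ h = b).card := by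
  obtain ⟨E', -, -, -, h3⟩ := remove_cross (χ := χ) (crossN χ E) hE le_rfl
  have h : frS χ E' b ⊆ Finset.univ.filter fun h => χ h = b := by
    intro h hh
    simpa using (mem_frS.1 hh).1
  have := Finset.card_le_card h
  have := h3 b
  omega

end

/-! ### Averages over uniform maximal matchings -/

/-- Average of `f` over the uniform maximal matching of labelled half-edges. -/
noncomputable def Av {V H : Type} [Fintype V] [Fintype H] (f : Multigraph → ℝ) (ℓ : H → V) : ℝ :=
  𝔼 m ∈ maxM H, f (gr ℓ m.val)

section
variable {V H : Type} [Fintype V] [Fintype H] {f : Multigraph → ℝ} {κ : ℝ}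

theorem configExpect_eq_Av (f : Multigraph → ℝ) (V : Type) [Fintype V] [DecidableEq V]
    (d : V → ℕ) : configExpect V d f = Av f (Sigma.fst : HalfEdge V d → V) := by
  have h : maximalMatchings V d = maxM (HalfEdge V d) := by
    ext m
    simp [maximalMatchings, maxM]
  unfold configExpect Av
  rw [h, Finset.expect_eq_sum_div_card]
  rfl

theorem expect_mapF {K : Type} [Fintype K] (e : H ≃ K) (g : Finset (Sym2 K) → ℝ) :
    𝔼 m ∈ maxM H, g (mapF e m) = 𝔼 m ∈ maxM K, g m :=
  Finset.expect_equiv (mapF e) (fun m => mem_maxM_mapF e m) (fun _ _ => rfl)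

theorem Av_comp_equiv {K : Type} [Fintype K] (e : H ≃ K) (ℓ : K → V) :
    Av f (ℓ ∘ e) = Av f ℓ := by
  unfold Av
  rw [← expect_mapF e]
  refine Finset.expect_congr rfl (fun m _ => ?_)
  rw [mapF_val, gr_map]

theorem Av_equiv_comp (hinv : GraphParam.Invariant f) {W : Type} [Fintype W] (e : V ≃ W)
    (ℓ : H → V) : Av f (e ∘ ℓ) = Av f ℓ := by
  unfold Av
  refine Finset.expect_congr rfl (fun m _ => ?_)
  refine (hinv _ _ e ?_).symm
  change _ = (m.val.map (Sym2.map ℓ)).map (Sym2.map e)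
  change m.val.map (Sym2.map (e ∘ ℓ)) = _
  rw [Multiset.map_map]
  refine Multiset.map_congr rfl (fun z _ => ?_)
  induction z with
  | h x y => simp

theorem Av_eq_expect_Phi {C : Type} (ℓ : H → V) (χ : H → C) :
    Av f ℓ = 𝔼 m ∈ maxM H, Phi f ℓ χ m.val := by
  unfold Phi
  rw [Finset.expect_comm]
  exact ((Finset.expect_congr rfl (g := fun _ : colG χ => Av f ℓ)
    (fun σ _ => Av_comp_equiv (f := f) (σ : Equiv.Perm H) ℓ)).trans
    (Finset.expect_const Finset.univ_nonempty _)).symm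

theorem Av_eq_perm (ℓ : H → V) {E : Multiset (Sym2 H)} (hE : IsMxm E) :
    Av f ℓ = 𝔼 σ : Equiv.Perm H, f (gr (ℓ ∘ σ) E) := by
  have h1 : ∀ m ∈ maxM H, (𝔼 σ : Equiv.Perm H, f (gr (ℓ ∘ σ) m.val)) =
      𝔼 σ : Equiv.Perm H, f (gr (ℓ ∘ σ) E) := by
    intro m hm
    rw [mem_maxM] at hm
    obtain ⟨τ, hτ⟩ := exists_perm_le' hE.1 hm.1 (hm.2 _ hE.1)
    have hτ' : E.map (Sym2.map τ) = m.val := by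
      refine Multiset.eq_of_le_of_card_le hτ ?_
      simpa using hE.2 _ hm.1
    rw [← hτ']
    refine Fintype.expect_equiv (Equiv.mulRight τ) _ _ (fun σ => ?_)
    rw [gr_map]
    rfl
  calc Av f ℓ = 𝔼 σ : Equiv.Perm H, Av f (ℓ ∘ σ) := by
        rw [Finset.expect_congr rfl (g := fun _ : Equiv.Perm H => Av f ℓ)
          (fun σ _ => Av_comp_equiv (f := f) (σ : Equiv.Perm H) ℓ)]
        rw [Finset.expect_const Finset.univ_nonempty]
    _ = 𝔼 m ∈ maxM H, 𝔼 σ : Equiv.Perm H, f (gr (ℓ ∘ σ) m.val) := by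
        unfold Av; rw [Finset.expect_comm]
    _ = 𝔼 m ∈ maxM H, 𝔼 σ : Equiv.Perm H, f (gr (ℓ ∘ σ) E) := Finset.expect_congr rfl h1
    _ = _ := Finset.expect_const (maxM_nonempty H) _

end

theorem split_mono {H₁ H₂ : Type} (E : Multiset (Sym2 (H₁ ⊕ H₂)))
    (h : crossN (Sum.isLeft (α := H₁) (β := H₂)) E = 0) :
    ∃ (E₁ : Multiset (Sym2 H₁)) (E₂ : Multiset (Sym2 H₂)),
      E = E₁.map (Sym2.map Sum.inl) + E₂.map (Sym2.map Sum.inr) := by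
  induction E using Multiset.induction_on with
  | empty => exact ⟨0, 0, by simp⟩
  | cons e E ih =>
    induction e with
    | h x y =>
      unfold crossN at h ih
      rw [Multiset.map_cons, Multiset.count_cons] at h
      obtain ⟨E₁, E₂, hE⟩ := ih (by omega)
      have hne : ¬ (s(true, false) = Sym2.map (Sum.isLeft (α := H₁) (β := H₂)) s(x, y)) := by
        intro hh; rw [if_pos hh] at h; omega
      rcases x with x | x <;> rcases y with y | y
      · exact ⟨s(x, y) ::ₘ E₁, E₂, by simp [hE]⟩
      · simp at hne
      · simp at hne
      · exact ⟨E₁, s(x, y) ::ₘ E₂, by simp [hE]⟩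

theorem IsM.of_map {H K : Type} {E : Multiset (Sym2 H)} {g : H → K}
    (hE : IsM (E.map (Sym2.map g))) : IsM E := by
  unfold IsM at hE
  rw [endp_map] at hE
  exact Multiset.Nodup.of_map _ hE

theorem isM_split {H₁ H₂ : Type} {E₁ : Multiset (Sym2 H₁)} {E₂ : Multiset (Sym2 H₂)}
    (h₁ : IsM E₁) (h₂ : IsM E₂) :
    IsM (E₁.map (Sym2.map Sum.inl) + E₂.map (Sym2.map (Sum.inr : H₂ → H₁ ⊕ H₂))) := by
  unfold IsM
  rw [endp_add, endp_map, endp_map, Multiset.nodup_add]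
  refine ⟨Multiset.Nodup.map Sum.inl_injective h₁, Multiset.Nodup.map Sum.inr_injective h₂, ?_⟩
  rw [Multiset.disjoint_left]
  intro a ha hb
  simp only [Multiset.mem_map] at ha hb
  obtain ⟨x, -, rfl⟩ := ha
  obtain ⟨y, -, hy⟩ := hb
  cases hy

theorem map_split_col {H₁ H₂ : Type} (E₁ : Multiset (Sym2 H₁)) (E₂ : Multiset (Sym2 H₂)) :
    (E₁.map (Sym2.map Sum.inl) + E₂.map (Sym2.map (Sum.inr : H₂ → H₁ ⊕ H₂))).map
      (Sym2.map Sum.isLeft) =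
      Multiset.replicate E₁.card s(true, true) + Multiset.replicate E₂.card s(false, false) := by
  rw [Multiset.map_add, Multiset.map_map, Multiset.map_map]
  congr 1 <;>
  · rw [Multiset.eq_replicate]
    refine ⟨by simp, ?_⟩
    intro b hb
    obtain ⟨z, -, rfl⟩ := Multiset.mem_map.1 hb
    induction z with
    | h x y => simp

section
variable {V₁ H₁ V₂ H₂ : Type} [Fintype V₁] [Fintype H₁] [Fintype V₂] [Fintype H₂]
  {f : Multigraph → ℝ} {κ : ℝ}

theorem f_gr_split (hadd : GraphParam.Additive f) (ℓ₁ : H₁ → V₁) (ℓ₂ : H₂ → V₂)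
    (E₁ : Multiset (Sym2 H₁)) (E₂ : Multiset (Sym2 H₂)) :
    f (gr (Sum.map ℓ₁ ℓ₂) (E₁.map (Sym2.map Sum.inl) + E₂.map (Sym2.map Sum.inr))) =
      f (gr ℓ₁ E₁) + f (gr ℓ₂ E₂) := by
  rw [← hadd]
  congr 1
  unfold gr Multigraph.disjUnion
  simp only [Multiset.map_add, Multiset.map_map]
  congr 2 <;>
  · refine Multiset.map_congr rfl (fun z _ => ?_)
    induction z with
    | h x y => simp

theorem colG_split (σ : Equiv.Perm (H₁ ⊕ H₂))
    (hσ : ∀ h, (σ h).isLeft = h.isLeft) :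
    ∃ (σ₁ : Equiv.Perm H₁) (σ₂ : Equiv.Perm H₂), σ = Equiv.sumCongr σ₁ σ₂ := by
  have := Equiv.Perm.mem_sumCongrHom_range_of_perm_mapsTo_inl (σ := σ) (by
    rintro _ ⟨x, rfl⟩
    have := hσ (Sum.inl x)
    rw [Sum.isLeft_inl, Sum.isLeft_iff] at this
    obtain ⟨y, hy⟩ := this
    exact ⟨y, hy.symm⟩)
  obtain ⟨⟨a, b⟩, h⟩ := this
  exact ⟨a, b, h.symm⟩

theorem Av_superadd_aux (hadd : GraphParam.Additive f)
    (hlip : GraphParam.Lipschitz f κ) (hconc : GraphParam.Concave f)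
    (ℓ₁ : H₁ → V₁) (ℓ₂ : H₂ → V₂) (c : ℕ)
    (hc : ∀ m ∈ maxM (H₁ ⊕ H₂), crossN (Sum.isLeft (α := H₁) (β := H₂)) m.val ≤ c) :
    Av f ℓ₁ + Av f ℓ₂ - 18 * κ * (c : ℝ) ^ (2 / 3 : ℝ) ≤ Av f (Sum.map ℓ₁ ℓ₂) := by
  have hκ := kappa_nonneg hlip
  set χ : H₁ ⊕ H₂ → Bool := Sum.isLeft
  set ℓ := Sum.map ℓ₁ ℓ₂ with hℓ
  let S : Finset (Sym2 H₁) → Finset (Sym2 H₂) → Multiset (Sym2 (H₁ ⊕ H₂)) := fun m₁ m₂ =>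
    m₁.val.map (Sym2.map Sum.inl) + m₂.val.map (Sym2.map Sum.inr)
  have h1 : ∀ m₁ ∈ maxM H₁, ∀ m₂ ∈ maxM H₂,
      Phi f ℓ χ (S m₁ m₂) - 18 * κ * (c : ℝ) ^ (2 / 3 : ℝ) ≤ Av f ℓ := by
    intro m₁ hm₁ m₂ hm₂
    rw [mem_maxM] at hm₁ hm₂
    rw [Av_eq_expect_Phi ℓ χ]
    refine Finset.le_expect (maxM_nonempty _) (fun m hm => ?_)
    have hcm := hc m hm
    rw [mem_maxM] at hm
    have h := interp_max hlip hconc ℓ χ (isM_split hm₁.1 hm₂.1) (by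
      intro E hE hE0
      obtain ⟨E₁, E₂, rfl⟩ := split_mono E hE0
      rw [map_split_col, map_split_col]
      have hE1 : IsM E₁ := (hE.mono (Multiset.le_add_right _ _)).of_map
      have hE2 : IsM E₂ := (hE.mono (Multiset.le_add_left _ _)).of_map
      exact add_le_add (Multiset.replicate_le_replicate _ |>.2 (hm₁.2 _ hE1))
        (Multiset.replicate_le_replicate _ |>.2 (hm₂.2 _ hE2))) hm
    refine le_trans ?_ h
    have : (crossN χ m.val : ℝ) ^ (2 / 3 : ℝ) ≤ (c : ℝ) ^ (2 / 3 : ℝ) :=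
      Real.rpow_le_rpow (by positivity) (by exact_mod_cast hcm) (by norm_num)
    have := mul_le_mul_of_nonneg_left this (by positivity : 0 ≤ 18 * κ)
    linarith
  have h2 : (𝔼 m₁ ∈ maxM H₁, 𝔼 m₂ ∈ maxM H₂, Phi f ℓ χ (S m₁ m₂)) = Av f ℓ₁ + Av f ℓ₂ := by
    have : ∀ σ : colG χ, (𝔼 m₁ ∈ maxM H₁, 𝔼 m₂ ∈ maxM H₂,
        f (gr (ℓ ∘ (σ : Equiv.Perm _)) (S m₁ m₂))) = Av f ℓ₁ + Av f ℓ₂ := by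
      rintro ⟨σ, hσ⟩
      obtain ⟨σ₁, σ₂, rfl⟩ := colG_split σ hσ
      have e : ℓ ∘ (Equiv.sumCongr σ₁ σ₂) = Sum.map (ℓ₁ ∘ σ₁) (ℓ₂ ∘ σ₂) := by
        funext x
        rcases x with x | x <;> simp [hℓ]
      simp only [e, S, f_gr_split hadd]
      simp only [Finset.expect_add_distrib, Finset.expect_const (maxM_nonempty _)]
      rw [← Av_comp_equiv σ₁ ℓ₁, ← Av_comp_equiv σ₂ ℓ₂]
      rfl
    calc _ = 𝔼 σ : colG χ, 𝔼 m₁ ∈ maxM H₁, 𝔼 m₂ ∈ maxM H₂,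
        f (gr (ℓ ∘ (σ : Equiv.Perm _)) (S m₁ m₂)) := by
          unfold Phi
          rw [Finset.expect_comm (s := Finset.univ)]
          refine Finset.expect_congr rfl (fun h _ => ?_)
          rw [Finset.expect_comm]
          congr!
      _ = _ := by
          rw [Finset.expect_congr rfl (fun σ _ => this σ), Finset.expect_const Finset.univ_nonempty]
  rw [← h2, sub_le_iff_le_add]
  refine Finset.expect_le (maxM_nonempty _) (fun m₁ hm₁ => ?_)
  refine Finset.expect_le (maxM_nonempty _) (fun m₂ hm₂ => ?_)
  linarith [h1 m₁ hm₁ m₂ hm₂]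

theorem Av_superadd (hadd : GraphParam.Additive f)
    (hlip : GraphParam.Lipschitz f κ) (hconc : GraphParam.Concave f)
    (ℓ₁ : H₁ → V₁) (ℓ₂ : H₂ → V₂) :
    Av f ℓ₁ + Av f ℓ₂ - 18 * κ * ((min (Fintype.card H₁) (Fintype.card H₂) : ℕ) : ℝ) ^ (2 / 3 : ℝ)
      ≤ Av f (Sum.map ℓ₁ ℓ₂) := by
  refine Av_superadd_aux hadd hlip hconc ℓ₁ ℓ₂ _ (fun m hm => ?_)
  rw [mem_maxM] at hm
  refine le_min ?_ ?_
  · refine (crossN_le hm.1 true).trans (le_of_eq ?_)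
    rw [← Finset.card_univ (α := H₁), ← Finset.card_map Function.Embedding.inl (s := Finset.univ)]
    congr 1
    ext x; rcases x with x | x <;> simp
  · refine (crossN_le hm.1 false).trans (le_of_eq ?_)
    rw [← Finset.card_univ (α := H₂), ← Finset.card_map Function.Embedding.inr (s := Finset.univ)]
    congr 1
    ext x; rcases x with x | x <;> simp

theorem remove_right (E : Multiset (Sym2 (H₁ ⊕ H₂))) :
    ∃ E₁ : Multiset (Sym2 H₁), E₁.map (Sym2.map Sum.inl) ≤ E ∧
      E.card ≤ E₁.card + ((endp E).filter (fun h => h.isRight = true)).card := by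
  induction E using Multiset.induction_on with
  | empty => exact ⟨0, by simp, by simp⟩
  | cons e E ih =>
    obtain ⟨E₁, h1, h2⟩ := ih
    induction e with
    | h x y =>
      have hc : ((endp (s(x, y) ::ₘ E)).filter (fun h => h.isRight = true)).card =
          (({x, y} : Multiset (H₁ ⊕ H₂)).filter (fun h => h.isRight = true)).card +
          ((endp E).filter (fun h => h.isRight = true)).card := by
        rw [endp_cons, toMultiset_mk, Multiset.filter_add, Multiset.card_add]
      rw [hc]
      rcases x with x | x
      · rcases y with y | y
        · exact ⟨s(x, y) ::ₘ E₁, by simpa using h1, by simp; omega⟩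
        · refine ⟨E₁, h1.trans (Multiset.le_cons_self _ _), ?_⟩
          simp [Multiset.filter_cons, Multiset.filter_singleton]; omega
      · refine ⟨E₁, h1.trans (Multiset.le_cons_self _ _), ?_⟩
        simp [Multiset.filter_cons]; omega

theorem Av_lip (hlip : GraphParam.Lipschitz f κ) (ℓ : H₁ ⊕ H₂ → V₁) :
    |Av f ℓ - Av f (ℓ ∘ Sum.inl)| ≤ 2 * κ * Fintype.card H₂ := by
  have hκ := kappa_nonneg hlip
  have h1 : Av f ℓ = 𝔼 m ∈ maxM (H₁ ⊕ H₂), 𝔼 τ : Equiv.Perm H₁,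
      f (gr (ℓ ∘ (Equiv.sumCongr τ (Equiv.refl H₂))) m.val) := by
    rw [Finset.expect_comm]
    exact ((Finset.expect_congr rfl (g := fun _ : Equiv.Perm H₁ => Av f ℓ)
      (fun τ _ => Av_comp_equiv (f := f) (Equiv.sumCongr τ (Equiv.refl H₂)) ℓ)).trans
      (Finset.expect_const Finset.univ_nonempty _)).symm
  obtain ⟨m₁, hm₁⟩ := maxM_nonempty H₁
  rw [mem_maxM] at hm₁
  have key : ∀ m ∈ maxM (H₁ ⊕ H₂), |(𝔼 τ : Equiv.Perm H₁,
      f (gr (ℓ ∘ (Equiv.sumCongr τ (Equiv.refl H₂))) m.val)) - Av f (ℓ ∘ Sum.inl)| ≤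
        2 * κ * Fintype.card H₂ := by
    intro m hm
    rw [mem_maxM] at hm
    obtain ⟨E₁, hle, hcard⟩ := remove_right m.val
    have hE₁ : IsM E₁ := (hm.1.mono hle).of_map
    have hc2 : ((endp m.val).filter (fun h => h.isRight = true)).card ≤ Fintype.card H₂ := by
      have hnd : ((endp m.val).filter (fun h => h.isRight = true)).Nodup :=
        Multiset.Nodup.filter _ hm.1
      have := Finset.card_le_card (s := ⟨_, hnd⟩)
        (t := Finset.univ.map (Function.Embedding.inr : H₂ ↪ H₁ ⊕ H₂)) (by
          intro x hx
          have hx : x ∈ (endp m.val).filter (fun h => h.isRight = true) := hx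
          rw [Multiset.mem_filter] at hx
          rcases x with x | x
          · simp at hx
          · simp)
      simpa using this
    obtain ⟨τ₀, hτ₀⟩ := exists_perm_le' hE₁ hm₁.1 (hm₁.2 _ hE₁)
    have hm1m : m₁.val.card ≤ m.val.card := by
      have := hm.2 _ (hm₁.1.map (g := (Sum.inl : H₁ → H₁ ⊕ H₂)) Sum.inl_injective)
      simpa using this
    obtain ⟨R, hR⟩ := Multiset.le_iff_exists_add.1 hle
    obtain ⟨R', hR'⟩ := Multiset.le_iff_exists_add.1 hτ₀
    have hRc : R.card ≤ Fintype.card H₂ := by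
      have := congrArg Multiset.card hR
      simp at this hcard; omega
    have hRc' : R'.card ≤ Fintype.card H₂ := by
      have := congrArg Multiset.card hR
      have := congrArg Multiset.card hR'
      simp at *; omega
    have hAv : Av f (ℓ ∘ Sum.inl) = 𝔼 τ : Equiv.Perm H₁, f (gr ((ℓ ∘ Sum.inl) ∘ (τ * τ₀⁻¹)) m₁.val) := by
      rw [Av_eq_perm _ hm₁]
      exact (Fintype.expect_equiv (Equiv.mulRight τ₀⁻¹) _ _ (fun σ => rfl)).symm
    rw [hAv, ← Finset.expect_sub_distrib]
    refine le_trans (Finset.abs_expect_le _ _) ?_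
    refine Finset.expect_le Finset.univ_nonempty (fun τ _ => ?_)
    have a1 := lip_gr_add hlip (ℓ ∘ (Equiv.sumCongr τ (Equiv.refl H₂)))
      (E₁.map (Sym2.map Sum.inl)) R
    have a2 := lip_gr_add hlip ((ℓ ∘ Sum.inl) ∘ ((τ * τ₀⁻¹ : Equiv.Perm H₁)))
      (E₁.map (Sym2.map τ₀)) R'
    rw [← hR, gr_map] at a1
    rw [← hR', gr_map] at a2
    have e : ((ℓ ∘ Sum.inl) ∘ ((τ * τ₀⁻¹ : Equiv.Perm H₁))) ∘ τ₀ =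
        (ℓ ∘ (Equiv.sumCongr τ (Equiv.refl H₂))) ∘ Sum.inl := by
      funext x; simp
    rw [e] at a2
    have b1 : κ * (R.card : ℝ) ≤ κ * Fintype.card H₂ :=
      mul_le_mul_of_nonneg_left (by exact_mod_cast hRc) hκ
    have b2 : κ * (R'.card : ℝ) ≤ κ * Fintype.card H₂ :=
      mul_le_mul_of_nonneg_left (by exact_mod_cast hRc') hκ
    rw [abs_le] at *
    constructor <;> linarith [a1.1, a1.2, a2.1, a2.2]
  rw [h1]
  have : (𝔼 m ∈ maxM (H₁ ⊕ H₂), 𝔼 τ : Equiv.Perm H₁,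
      f (gr (ℓ ∘ (Equiv.sumCongr τ (Equiv.refl H₂))) m.val)) - Av f (ℓ ∘ Sum.inl) =
      𝔼 m ∈ maxM (H₁ ⊕ H₂), ((𝔼 τ : Equiv.Perm H₁,
      f (gr (ℓ ∘ (Equiv.sumCongr τ (Equiv.refl H₂))) m.val)) - Av f (ℓ ∘ Sum.inl)) := by
    rw [Finset.expect_sub_distrib, Finset.expect_const (maxM_nonempty _)]
  rw [this]
  refine le_trans (Finset.abs_expect_le _ _) ?_
  exact Finset.expect_le (maxM_nonempty _) key

end

/-- The value of `f` on a single vertex. -/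
noncomputable def fpt (f : Multigraph → ℝ) : ℝ := f { V := Unit, edges := 0 }

theorem f_edgeless {f : Multigraph → ℝ} (hinv : GraphParam.Invariant f)
    (hadd : GraphParam.Additive f) (V : Type) [Fintype V] :
    f { V := V, edges := 0 } = fpt f * Fintype.card V := by
  have hfin : ∀ n : ℕ, f { V := Fin n, edges := 0 } = fpt f * n := by
    intro n
    induction n with
    | zero =>
      have h := hadd { V := Fin 0, edges := 0 } { V := Fin 0, edges := 0 }
      have h' : f ({ V := Fin 0, edges := 0 } : Multigraph) =
          f (Multigraph.disjUnion { V := Fin 0, edges := 0 } { V := Fin 0, edges := 0 }) :=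
        hinv _ _ (Equiv.equivOfIsEmpty (Fin 0) (Fin 0 ⊕ Fin 0)) rfl
      simp only [Nat.cast_zero, mul_zero]
      linarith
    | succ n ih =>
      have h := hadd { V := Fin n, edges := 0 } { V := Unit, edges := 0 }
      have h' : f ({ V := Fin (n + 1), edges := 0 } : Multigraph) =
          f (Multigraph.disjUnion { V := Fin n, edges := 0 } { V := Unit, edges := 0 }) :=
        hinv _ _ (finSumFinEquiv.symm.trans
          (Equiv.sumCongr (Equiv.refl _) (Equiv.equivPUnit (Fin 1)))) rfl
      rw [h', h, ih]
      unfold fpt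
      push_cast; ring
  rw [hinv { V := V, edges := 0 } { V := Fin (Fintype.card V), edges := 0 }
    (Fintype.equivFin V) rfl, hfin]

theorem Av_isolated {V H W : Type} [Fintype V] [Fintype H] [Fintype W] {f : Multigraph → ℝ}
    (hinv : GraphParam.Invariant f)
    (hadd : GraphParam.Additive f) (ℓ : H → V) :
    Av f (Sum.inl ∘ ℓ : H → V ⊕ W) = Av f ℓ + fpt f * Fintype.card W := by
  unfold Av
  have : ∀ m ∈ maxM H, f (gr (Sum.inl ∘ ℓ : H → V ⊕ W) m.val) =
      f (gr ℓ m.val) + fpt f * Fintype.card W := by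
    intro m _
    rw [← f_edgeless hinv hadd W, ← hadd]
    congr 1
    unfold gr Multigraph.disjUnion
    simp only [Multiset.map_map, Multiset.map_zero, add_zero]
    congr 1
    refine Multiset.map_congr rfl (fun z _ => ?_)
    induction z with
    | h x y => simp
  rw [Finset.expect_congr rfl this, Finset.expect_add_distrib,
    Finset.expect_const (maxM_nonempty _)]

/-! ### Degree multisets -/

/-- Normalised expectation for a degree function. -/
noncomputable def Fd (f : Multigraph → ℝ) (V : Type) [Fintype V] (d : V → ℕ) : ℝ :=
  Av f (Sigma.fst : HalfEdge V d → V) - fpt f * Fintype.card V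

/-- Normalised expectation for a degree multiset. -/
noncomputable def Dm (f : Multigraph → ℝ) (s : Multiset ℕ) : ℝ :=
  Fd f (Fin s.toList.length) s.toList.get

section
variable {f : Multigraph → ℝ} {κ : ℝ}

theorem Fd_comp (hinv : GraphParam.Invariant f) {V W : Type} [Fintype V] [Fintype W] (e : V ≃ W)
    (d : W → ℕ) : Fd f V (d ∘ e) = Fd f W d := by
  unfold Fd
  rw [Fintype.card_congr e, ← Av_equiv_comp hinv e]
  congr 1
  let E : HalfEdge V (d ∘ e) ≃ HalfEdge W d := Equiv.sigmaCongrLeft (β := fun w => Fin (d w)) e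
  exact Av_comp_equiv (f := f) E (Sigma.fst : HalfEdge W d → W)

theorem Fd_congr (hinv : GraphParam.Invariant f) {V W : Type} [Fintype V] [Fintype W]
    (d : V → ℕ) (d' : W → ℕ)
    (h : (Finset.univ : Finset V).val.map d = (Finset.univ : Finset W).val.map d') :
    Fd f V d = Fd f W d' := by
  have hfib : ∀ c : ℕ, Nonempty ({v : V // d v = c} ≃ {w : W // d' w = c}) := by
    intro c
    refine ⟨Fintype.equivOfCardEq ?_⟩
    have h1 := congrArg (Multiset.count c) h
    rw [Multiset.count_map, Multiset.count_map] at h1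
    rw [Fintype.card_subtype, Fintype.card_subtype]
    simpa [Finset.card, eq_comm] using h1
  have hd : d = d' ∘ (Equiv.ofFiberEquiv fun c => (hfib c).some) := by
    funext v
    exact (Equiv.ofFiberEquiv_map (fun c => (hfib c).some) v).symm
  rw [hd, Fd_comp hinv]

theorem univ_map_get (l : List ℕ) : (Finset.univ : Finset (Fin l.length)).val.map l.get = l := by
  simp

theorem Fd_eq_Dm (hinv : GraphParam.Invariant f) {V : Type} [Fintype V]
    (d : V → ℕ) : Fd f V d = Dm f ((Finset.univ : Finset V).val.map d) := by
  refine Fd_congr hinv _ _ ?_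
  rw [univ_map_get, Multiset.coe_toList]

theorem configExpect_eq_Dm (hinv : GraphParam.Invariant f) (V : Type) [Fintype V] [DecidableEq V]
    (d : V → ℕ) : configExpect V d f =
      Dm f ((Finset.univ : Finset V).val.map d) + fpt f * Fintype.card V := by
  rw [← Fd_eq_Dm hinv, configExpect_eq_Av, Fd]
  ring

theorem Av_sum (V W : Type) [Fintype V] [Fintype W] (d : V → ℕ) (d' : W → ℕ) :
    Av f (Sigma.fst : HalfEdge (V ⊕ W) (Sum.elim d d') → V ⊕ W) =
      Av f (Sum.map (Sigma.fst : HalfEdge V d → V) (Sigma.fst : HalfEdge W d' → W)) := by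
  let E : HalfEdge (V ⊕ W) (Sum.elim d d') ≃ HalfEdge V d ⊕ HalfEdge W d' :=
    Equiv.sumSigmaDistrib (fun x : V ⊕ W => Fin (Sum.elim d d' x))
  rw [← Av_comp_equiv E]
  congr 1
  funext ⟨x, i⟩
  rcases x with x | x <;> rfl

theorem card_halfEdge (V : Type) [Fintype V] (d : V → ℕ) :
    Fintype.card (HalfEdge V d) = ((Finset.univ : Finset V).val.map d).sum := by
  rw [Fintype.card_sigma]
  simp

theorem univ_map_sum (V W : Type) [Fintype V] [Fintype W] (d : V → ℕ) (d' : W → ℕ) :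
    (Finset.univ : Finset (V ⊕ W)).val.map (Sum.elim d d') =
      (Finset.univ : Finset V).val.map d + (Finset.univ : Finset W).val.map d' := by
  have : (Finset.univ : Finset (V ⊕ W)).val =
      (Finset.univ : Finset V).val.map Sum.inl + (Finset.univ : Finset W).val.map Sum.inr := rfl
  rw [this, Multiset.map_add, Multiset.map_map, Multiset.map_map]
  rfl

theorem Dm_add (hinv : GraphParam.Invariant f) (s t : Multiset ℕ) :
    Dm f (s + t) = Av f (Sum.map (Sigma.fst : HalfEdge _ s.toList.get → _)
      (Sigma.fst : HalfEdge _ t.toList.get → _)) - fpt f * s.card - fpt f * t.card := by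
  rw [← Av_sum]
  have h := Fd_eq_Dm (f := f) hinv (Sum.elim s.toList.get t.toList.get)
  rw [univ_map_sum, univ_map_get, univ_map_get, Multiset.coe_toList, Multiset.coe_toList] at h
  rw [← h, Fd]
  simp
  ring

theorem Dm_lip (hinv : GraphParam.Invariant f) (hadd : GraphParam.Additive f)
    (hlip : GraphParam.Lipschitz f κ) (s t : Multiset ℕ) :
    |Dm f (s + t) - Dm f s| ≤ 2 * κ * t.sum := by
  rw [Dm_add hinv]
  have h := Av_lip hlip (Sum.map (Sigma.fst : HalfEdge _ s.toList.get → _)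
      (Sigma.fst : HalfEdge _ t.toList.get → _))
  rw [card_halfEdge, univ_map_get, Multiset.coe_toList] at h
  have e := Av_isolated (W := Fin t.toList.length) hinv hadd
    (Sigma.fst : HalfEdge _ s.toList.get → _)
  change |_ - Av f (Sum.inl ∘ Sigma.fst)| ≤ _ at h
  rw [e] at h
  refine le_trans (le_of_eq ?_) h
  congr 1
  unfold Dm Fd
  simp
  ring

theorem Dm_superadd (hinv : GraphParam.Invariant f) (hadd : GraphParam.Additive f)
    (hlip : GraphParam.Lipschitz f κ) (hconc : GraphParam.Concave f) (s t : Multiset ℕ) :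
    Dm f s + Dm f t - 18 * κ * ((min s.sum t.sum : ℕ) : ℝ) ^ (2 / 3 : ℝ) ≤ Dm f (s + t) := by
  rw [Dm_add hinv]
  have h := Av_superadd hadd hlip hconc (Sigma.fst : HalfEdge _ s.toList.get → _)
      (Sigma.fst : HalfEdge _ t.toList.get → _)
  rw [card_halfEdge, card_halfEdge, univ_map_get, univ_map_get,
    Multiset.coe_toList, Multiset.coe_toList] at h
  unfold Dm Fd
  simp only [Fintype.card_fin, Multiset.length_toList]
  linarith

theorem Dm_zero (hinv : GraphParam.Invariant f) (hadd : GraphParam.Additive f) :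
    Dm f 0 = 0 := by
  have h := Fd_eq_Dm (f := f) hinv (V := Empty) (fun _ => 0)
  have e : (Finset.univ : Finset Empty).val.map (fun _ => 0) = 0 := rfl
  rw [e] at h
  rw [← h, Fd, Av]
  simp only [Fintype.card_empty, Nat.cast_zero, mul_zero, sub_zero]
  rw [Finset.expect_congr rfl (g := fun _ => (0 : ℝ)), Finset.expect_const_zero]
  intro m _
  have : gr (Sigma.fst : HalfEdge Empty (fun _ => 0) → Empty) m.val = { V := Empty, edges := 0 } := by
    unfold gr
    congr 1
    rw [Multiset.eq_zero_iff_forall_notMem]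
    intro a
    induction a with
    | h x y => exact x.elim
  rw [this, f_edgeless hinv hadd]
  simp

theorem two_thirds {x y : ℝ} (hx : 0 ≤ x) (hxy : x ≤ y) :
    (x + y) ^ (2 / 3 : ℝ) ≤ y ^ (2 / 3 : ℝ) + 3 / 4 * x ^ (2 / 3 : ℝ) := by
  have hy : 0 ≤ y := hx.trans hxy
  set a := x ^ (1 / 3 : ℝ) with ha
  set b := y ^ (1 / 3 : ℝ) with hb
  have ha0 : 0 ≤ a := Real.rpow_nonneg hx _
  have hb0 : 0 ≤ b := Real.rpow_nonneg hy _
  have hab : a ≤ b := Real.rpow_le_rpow hx hxy (by norm_num)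
  have e1 : x ^ (2 / 3 : ℝ) = a ^ 2 := by
    rw [ha, ← Real.rpow_natCast, ← Real.rpow_mul hx]; norm_num
  have e2 : y ^ (2 / 3 : ℝ) = b ^ 2 := by
    rw [hb, ← Real.rpow_natCast, ← Real.rpow_mul hy]; norm_num
  have e3 : x = a ^ 3 := by
    rw [ha, ← Real.rpow_natCast, ← Real.rpow_mul hx]; norm_num
  have e4 : y = b ^ 3 := by
    rw [hb, ← Real.rpow_natCast, ← Real.rpow_mul hy]; norm_num
  have e5 : (x + y) ^ (2 / 3 : ℝ) = ((x + y) ^ 2) ^ (1 / 3 : ℝ) := by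
    rw [← Real.rpow_natCast, ← Real.rpow_mul (by positivity)]; norm_num
  have e6 : b ^ 2 + 3 / 4 * a ^ 2 = ((b ^ 2 + 3 / 4 * a ^ 2) ^ 3) ^ (1 / 3 : ℝ) := by
    rw [← Real.rpow_natCast (b ^ 2 + 3 / 4 * a ^ 2), ← Real.rpow_mul (by positivity)]; norm_num
  rw [e1, e2, e5, e6]
  refine Real.rpow_le_rpow (by positivity) ?_ (by norm_num)
  rw [e3, e4]
  have i1 : 0 ≤ b ^ 3 * a ^ 2 * (b - a) := by
    have : 0 ≤ b - a := by linarith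
    positivity
  have i2 : 0 ≤ a ^ 4 * (b ^ 2 - a ^ 2) := by
    have : 0 ≤ b ^ 2 - a ^ 2 := by nlinarith
    positivity
  have i3 : 0 ≤ b ^ 3 * a ^ 3 := by positivity
  have i4 : 0 ≤ a ^ 6 := by positivity
  nlinarith

/-- The correction term. -/
noncomputable def psi (κ : ℝ) (h : ℕ) : ℝ := 72 * κ * (h : ℝ) ^ (2 / 3 : ℝ)

theorem psi_add (hκ : 0 ≤ κ) (x y : ℕ) :
    psi κ (x + y) + 18 * κ * ((min x y : ℕ) : ℝ) ^ (2 / 3 : ℝ) ≤ psi κ x + psi κ y := by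
  wlog hxy : x ≤ y generalizing x y
  · rw [add_comm x y, min_comm, add_comm (psi κ x)]
    exact this y x (by omega)
  rw [min_eq_left hxy]
  unfold psi
  have h := two_thirds (x := x) (y := y) (by positivity) (by exact_mod_cast hxy)
  push_cast
  nlinarith

theorem Gm_superadd (hinv : GraphParam.Invariant f) (hadd : GraphParam.Additive f)
    (hlip : GraphParam.Lipschitz f κ) (hconc : GraphParam.Concave f) (s t : Multiset ℕ) :
    (Dm f s - psi κ s.sum) + (Dm f t - psi κ t.sum) ≤ Dm f (s + t) - psi κ (s + t).sum := by
  have h := Dm_superadd hinv hadd hlip hconc s t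
  have h2 := psi_add (kappa_nonneg hlip) s.sum t.sum
  rw [Multiset.sum_add]
  linarith

theorem psi_nonneg (hκ : 0 ≤ κ) (x : ℕ) : 0 ≤ psi κ x := by unfold psi; positivity

theorem Dm_nsmul (hinv : GraphParam.Invariant f) (hadd : GraphParam.Additive f)
    (hlip : GraphParam.Lipschitz f κ) (hconc : GraphParam.Concave f) (s : Multiset ℕ) (q : ℕ) :
    q * (Dm f s - psi κ s.sum) ≤ Dm f (q • s) := by
  have h : q * (Dm f s - psi κ s.sum) ≤ Dm f (q • s) - psi κ (q • s).sum := by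
    induction q with
    | zero => simp [Dm_zero hinv hadd, psi]
    | succ q ih =>
      have := Gm_superadd hinv hadd hlip hconc (q • s) s
      rw [succ_nsmul]
      push_cast
      linarith
  linarith [psi_nonneg (kappa_nonneg hlip) (q • s).sum]

/-- Truncated degree sum. -/
noncomputable def low (K : ℕ) (s : Multiset ℕ) : ℝ := ∑ k ∈ Finset.range K, (k : ℝ) * s.count k

theorem low_add (K : ℕ) (s t : Multiset ℕ) : low K (s + t) = low K s + low K t := by
  unfold low
  rw [← Finset.sum_add_distrib]
  refine Finset.sum_congr rfl (fun k _ => ?_)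
  rw [Multiset.count_add]; push_cast; ring

theorem low_le (K : ℕ) (s : Multiset ℕ) : low K s ≤ s.sum := by
  induction s using Multiset.induction_on with
  | empty => simp [low]
  | cons a s ih =>
    rw [← Multiset.singleton_add, low_add, Multiset.sum_add]
    have : low K {a} ≤ a := by
      unfold low
      simp only [Multiset.count_singleton]
      simp
      split_ifs <;> simp
    simp only [Multiset.sum_singleton]
    rw [Nat.cast_add]
    linarith

theorem Dm_dist (hinv : GraphParam.Invariant f) (hadd : GraphParam.Additive f)
    (hlip : GraphParam.Lipschitz f κ) (s t : Multiset ℕ) (K : ℕ) :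
    |Dm f s - Dm f t| ≤ 2 * κ * ((∑ k ∈ Finset.range K, (k : ℝ) * |(s.count k : ℝ) - t.count k|)
      + (s.sum - low K s) + (t.sum - low K t)) := by
  have hκ := kappa_nonneg hlip
  have hs : s ∩ t + (s - t) = s := by
    rw [add_comm]; exact Multiset.sub_add_inter s t
  have ht : s ∩ t + (t - s) = t := by
    rw [Multiset.inter_comm, add_comm]; exact Multiset.sub_add_inter t s
  have h1 := Dm_lip hinv hadd hlip (s ∩ t) (s - t)
  have h2 := Dm_lip hinv hadd hlip (s ∩ t) (t - s)
  rw [hs] at h1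
  rw [ht] at h2
  have l0 := low_le K (s ∩ t)
  have l1 : low K s = low K (s ∩ t) + low K (s - t) := by rw [← low_add, hs]
  have l2 : low K t = low K (s ∩ t) + low K (t - s) := by rw [← low_add, ht]
  have m1 : (s.sum : ℝ) = (s ∩ t).sum + (s - t).sum := by
    rw [← Nat.cast_add, ← Multiset.sum_add, hs]
  have m2 : (t.sum : ℝ) = (s ∩ t).sum + (t - s).sum := by
    rw [← Nat.cast_add, ← Multiset.sum_add, ht]
  have l3 : low K (s - t) + low K (t - s) =
      ∑ k ∈ Finset.range K, (k : ℝ) * |(s.count k : ℝ) - t.count k| := by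
    unfold low
    rw [← Finset.sum_add_distrib]
    refine Finset.sum_congr rfl (fun k _ => ?_)
    rw [← mul_add, Multiset.count_sub, Multiset.count_sub]
    congr 1
    rcases le_total (s.count k) (t.count k) with h | h
    · rw [Nat.sub_eq_zero_of_le h, Nat.cast_sub h, abs_of_nonpos]
      · push_cast; ring
      · have : (s.count k : ℝ) ≤ t.count k := by exact_mod_cast h
        linarith
    · rw [Nat.sub_eq_zero_of_le h, Nat.cast_sub h, abs_of_nonneg]
      · push_cast; ring
      · have : (t.count k : ℝ) ≤ s.count k := by exact_mod_cast h
        linarith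
  have fin : ((s - t).sum : ℝ) + (t - s).sum ≤
      (∑ k ∈ Finset.range K, (k : ℝ) * |(s.count k : ℝ) - t.count k|)
      + (s.sum - low K s) + (t.sum - low K t) := by
    rw [← l3]; linarith
  have := mul_le_mul_of_nonneg_left fin (by positivity : 0 ≤ 2 * κ)
  refine le_trans ?_ this
  rw [abs_le] at *
  constructor <;> nlinarith [h1.1, h1.2, h2.1, h2.2]

end

/-! ### The deterministic limit -/

theorem exists_limit_of_superadd {a : ℕ → ℝ} {C : ℝ} (hb : ∀ᶠ n in atTop, |a n| ≤ C)
    (h : ∀ ε > 0, ∀ᶠ N in atTop, ∀ᶠ n in atTop, a N - ε ≤ a n) :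
    ∃ L, Tendsto a atTop (𝓝 L) := by
  have hlo : IsBoundedUnder (· ≥ ·) atTop a :=
    ⟨-C, by simpa using hb.mono (fun n hn => (abs_le.1 hn).1)⟩
  have hhi : IsBoundedUnder (· ≤ ·) atTop a :=
    ⟨C, by simpa using hb.mono (fun n hn => (abs_le.1 hn).2)⟩
  refine ⟨liminf a atTop, tendsto_of_le_liminf_of_limsup_le le_rfl ?_ hhi hlo⟩
  refine le_of_forall_pos_le_add (fun ε hε => ?_)
  refine limsup_le_of_le hlo.isCoboundedUnder_le ?_
  filter_upwards [h ε hε] with N hN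
  have := le_liminf_of_le hhi.isCoboundedUnder_ge hN
  linarith

theorem tendsto_div_div {N : ℕ} :
    Tendsto (fun n : ℕ => ((n / N : ℕ) : ℝ) / n) atTop (𝓝 (1 / N)) := by
  have h := (tendsto_nat_floor_mul_div_atTop (R := ℝ) (a := 1 / N) (by positivity)).comp
    tendsto_natCast_atTop_atTop
  refine h.congr (fun n => ?_)
  simp only [Function.comp]
  rw [one_div, mul_comm, ← div_eq_mul_inv, Nat.floor_div_eq_div]

section
variable {f : Multigraph → ℝ} {κ : ℝ}

theorem psi_div_tendsto {x : ℕ → ℕ} {b : ℝ}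
    (h : Tendsto (fun n => (x n : ℝ) / n) atTop (𝓝 b)) :
    Tendsto (fun n => psi κ (x n) / n) atTop (𝓝 0) := by
  have h1 : Tendsto (fun n => ((x n : ℝ) / n) ^ (2 / 3 : ℝ)) atTop (𝓝 (b ^ (2 / 3 : ℝ))) :=
    h.rpow_const (Or.inr (by norm_num))
  have h2 : Tendsto (fun n : ℕ => (n : ℝ) ^ (-(1 / 3) : ℝ)) atTop (𝓝 0) :=
    (tendsto_rpow_neg_atTop (by norm_num)).comp tendsto_natCast_atTop_atTop
  have h3 := (h1.mul h2).const_mul (72 * κ)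
  simp only [mul_zero] at h3
  refine h3.congr' ?_
  filter_upwards [eventually_ge_atTop 1] with n hn
  have hn0 : (0 : ℝ) < n := by exact_mod_cast hn
  unfold psi
  rw [Real.div_rpow (by positivity) (by positivity)]
  have : (n : ℝ) ^ (-(1 / 3) : ℝ) = (n : ℝ) ^ (2 / 3 : ℝ) / n := by
    have h := Real.rpow_sub hn0 (2 / 3) 1
    rw [Real.rpow_one] at h
    rw [← h]; norm_num
  rw [this]
  have : (n : ℝ) ^ (2 / 3 : ℝ) ≠ 0 := by positivity
  field_simp

theorem det_limit (hinv : GraphParam.Invariant f) (hadd : GraphParam.Additive f)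
    (hlip : GraphParam.Lipschitz f κ) (hconc : GraphParam.Concave f)
    {μ : ℕ → ℝ} (hμmean : Summable fun k : ℕ => (k : ℝ) * μ k)
    {s : ℕ → Multiset ℕ}
    (hs1 : ∀ k, Tendsto (fun n => ((s n).count k : ℝ) / n) atTop (𝓝 (μ k)))
    (hs2 : Tendsto (fun n => ((s n).sum : ℝ) / n) atTop (𝓝 (∑' k : ℕ, (k : ℝ) * μ k))) :
    ∃ L, Tendsto (fun n => Dm f (s n) / n) atTop (𝓝 L) := by
  have hκ := kappa_nonneg hlip
  set b := ∑' k : ℕ, (k : ℝ) * μ k with hb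
  have hlow : ∀ K, Tendsto (fun n => low K (s n) / n) atTop
      (𝓝 (∑ k ∈ Finset.range K, (k : ℝ) * μ k)) := by
    intro K
    have : Tendsto (fun n => ∑ k ∈ Finset.range K, (k : ℝ) * (((s n).count k : ℝ) / n)) atTop
      (𝓝 (∑ k ∈ Finset.range K, (k : ℝ) * μ k)) :=
      tendsto_finsetSum _ (fun k _ => (hs1 k).const_mul _)
    refine this.congr (fun n => ?_)
    unfold low
    rw [Finset.sum_div]
    refine Finset.sum_congr rfl (fun k _ => by ring)
  refine exists_limit_of_superadd (C := 2 * κ * (b + 1)) ?_ ?_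
  · filter_upwards [hs2.eventually (gt_mem_nhds (lt_add_one b)), eventually_ge_atTop 1] with n h1 h2
    have hn0 : (0 : ℝ) < n := by exact_mod_cast h2
    have h := Dm_lip hinv hadd hlip 0 (s n)
    rw [zero_add, Dm_zero hinv hadd, sub_zero] at h
    rw [abs_div, abs_of_pos hn0, div_le_iff₀ hn0]
    rw [div_lt_iff₀ hn0] at h1
    have := mul_le_mul_of_nonneg_left h1.le (by positivity : 0 ≤ 2 * κ)
    linarith
  · intro ε hε
    have hτ : Tendsto (fun K => 4 * κ * (b - ∑ k ∈ Finset.range K, (k : ℝ) * μ k)) atTop (𝓝 0) := by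
      have := ((hμmean.hasSum.tendsto_sum_nat).const_sub b).const_mul (4 * κ)
      simpa [hb] using this
    obtain ⟨K, hK⟩ := (hτ.eventually (gt_mem_nhds (by linarith : 0 < ε / 3))).exists
    set τ := b - ∑ k ∈ Finset.range K, (k : ℝ) * μ k with hτd
    let L : ℕ → ℝ := fun N => (1 / N) * (Dm f (s N) - psi κ (s N).sum) -
      2 * κ * ((∑ k ∈ Finset.range K, (k : ℝ) * |μ k - (1 / N) * ((s N).count k : ℝ)|)
      + τ + (1 / N) * ((s N).sum - low K (s N)))
    have hL : ∀ᶠ N in atTop, Dm f (s N) / N - 2 * ε / 3 < L N := by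
      have t1 : Tendsto (fun N : ℕ => ∑ k ∈ Finset.range K,
          (k : ℝ) * |μ k - (1 / N) * ((s N).count k : ℝ)|) atTop (𝓝 0) := by
        have : Tendsto (fun N : ℕ => ∑ k ∈ Finset.range K,
          (k : ℝ) * |μ k - ((s N).count k : ℝ) / N|) atTop
            (𝓝 (∑ k ∈ Finset.range K, (k : ℝ) * |μ k - μ k|)) :=
          tendsto_finsetSum _ (fun k _ => (((hs1 k).const_sub _).abs).const_mul _)
        simp only [sub_self, abs_zero, mul_zero, Finset.sum_const_zero] at this
        refine this.congr (fun N => Finset.sum_congr rfl (fun k _ => ?_))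
        rw [one_div_mul_eq_div]
      have t2 : Tendsto (fun N : ℕ => ((s N).sum : ℝ) / N - low K (s N) / N) atTop (𝓝 τ) :=
        hs2.sub (hlow K)
      have t3 := psi_div_tendsto (κ := κ) hs2
      have t4 := (((t1.add_const τ).add t2).const_mul (2 * κ)).add t3
      have e : 2 * κ * (0 + τ + τ) + 0 = 4 * κ * τ := by ring
      rw [e] at t4
      filter_upwards [t4.eventually (gt_mem_nhds (by linarith : 4 * κ * τ < 2 * ε / 3))] with N hN
      have : L N = Dm f (s N) / N - (2 * κ * ((∑ k ∈ Finset.range K,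
          (k : ℝ) * |μ k - (1 / N) * ((s N).count k : ℝ)|) + τ +
          (((s N).sum : ℝ) / N - low K (s N) / N)) + psi κ (s N).sum / N) := by
        simp only [L]; ring
      linarith
    filter_upwards [hL] with N hN
    have hq := tendsto_div_div (N := N)
    have hLB : Tendsto (fun n : ℕ => (((n / N : ℕ) : ℝ) / n) * (Dm f (s N) - psi κ (s N).sum) -
      2 * κ * ((∑ k ∈ Finset.range K,
          (k : ℝ) * |((s n).count k : ℝ) / n - (((n / N : ℕ) : ℝ) / n) * ((s N).count k : ℝ)|)
      + (((s n).sum : ℝ) / n - low K (s n) / n)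
      + (((n / N : ℕ) : ℝ) / n) * ((s N).sum - low K (s N)))) atTop (𝓝 (L N)) := by
      refine (hq.mul_const _).sub (((Tendsto.add ?_ (hs2.sub (hlow K))).add
        (hq.mul_const _)).const_mul _)
      exact tendsto_finsetSum _ (fun k _ => (((hs1 k).sub (hq.mul_const _)).abs).const_mul _)
    filter_upwards [hLB.eventually (lt_mem_nhds (by linarith : L N - ε / 3 < L N)),
      eventually_ge_atTop 1] with n h1 h2
    have hn0 : (0 : ℝ) < n := by exact_mod_cast h2
    have hd := (abs_le.1 (Dm_dist hinv hadd hlip (s n) ((n / N) • s N) K)).1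
    have hm := Dm_nsmul hinv hadd hlip hconc (s N) (n / N)
    have elow : low K ((n / N) • s N) = ((n / N : ℕ) : ℝ) * low K (s N) := by
      unfold low
      rw [Finset.mul_sum]
      refine Finset.sum_congr rfl (fun k _ => ?_)
      rw [Multiset.count_nsmul]; push_cast; ring
    have esum : ((((n / N) • s N).sum : ℕ) : ℝ) = ((n / N : ℕ) : ℝ) * (s N).sum := by
      rw [Multiset.sum_nsmul]; simp
    rw [elow, esum] at hd
    have e1 : ∑ k ∈ Finset.range K,
          (k : ℝ) * |((s n).count k : ℝ) / n - (((n / N : ℕ) : ℝ) / n) * ((s N).count k : ℝ)| =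
        (∑ k ∈ Finset.range K, (k : ℝ) * |((s n).count k : ℝ) - (((n / N) • s N).count k : ℝ)|) / n := by
      rw [Finset.sum_div]
      refine Finset.sum_congr rfl (fun k _ => ?_)
      rw [Multiset.count_nsmul, mul_div_assoc]
      congr 1
      rw [← abs_of_pos hn0, ← abs_div, abs_of_pos hn0]
      congr 1
      push_cast; ring
    rw [e1] at h1
    have key := (sub_le_sub hm hd)
    have h3 : L N - ε / 3 ≤ Dm f (s n) / n := by
      refine h1.le.trans ?_
      rw [le_div_iff₀ hn0]
      refine le_trans (le_of_eq ?_) (by linarith [hd, hm] :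
        ((n / N : ℕ) : ℝ) * (Dm f (s N) - psi κ (s N).sum) - 2 * κ * ((∑ k ∈ Finset.range K,
          (k : ℝ) * |((s n).count k : ℝ) - (((n / N) • s N).count k : ℝ)|) +
          ((s n).sum - low K (s n)) + (((n / N : ℕ) : ℝ) * (s N).sum -
            ((n / N : ℕ) : ℝ) * low K (s N))) ≤ Dm f (s n))
      field_simp
    linarith

end

/-! ### The i.i.d. average -/

theorem exists_nu {μ : ℕ → ℝ} (hμ0 : ∀ k, 0 ≤ μ k) (hμ1 : HasSum μ 1)
    (hμmean : Summable fun k : ℕ => (k : ℝ) * μ k) :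
    ∃ ν : Measure ℕ, IsProbabilityMeasure ν ∧ (∀ k, ν.real {k} = μ k) ∧
      Integrable (fun k : ℕ => (k : ℝ)) ν ∧ ∫ k : ℕ, (k : ℝ) ∂ν = ∑' k : ℕ, (k : ℝ) * μ k := by
  let p : PMF ℕ := ⟨fun k => ENNReal.ofReal (μ k), by
    have h := ENNReal.ofReal_tsum_of_nonneg hμ0 hμ1.summable
    rw [hμ1.tsum_eq, ENNReal.ofReal_one] at h
    rw [h]
    exact ENNReal.summable.hasSum⟩
  have hp : ∀ k, p.toMeasure {k} = ENNReal.ofReal (μ k) := fun k =>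
    p.toMeasure_apply_singleton k (measurableSet_singleton k)
  have hp' : ∀ k, p.toMeasure.real {k} = μ k := fun k => by
    rw [measureReal_def, hp, ENNReal.toReal_ofReal (hμ0 k)]
  have hintg : Integrable (fun k : ℕ => (k : ℝ)) p.toMeasure := by
    refine ⟨(Measurable.of_discrete).aestronglyMeasurable, ?_⟩
    unfold HasFiniteIntegral
    rw [lintegral_countable']
    have : ∀ k : ℕ, ‖(k : ℝ)‖ₑ * p.toMeasure {k} = ENNReal.ofReal (k * μ k) := by
      intro k
      rw [hp, ENNReal.ofReal_mul (by positivity), Real.enorm_of_nonneg (by positivity)]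
    simp_rw [this]
    exact hμmean.tsum_ofReal_lt_top
  refine ⟨p.toMeasure, inferInstance, hp', hintg, ?_⟩
  rw [integral_countable hintg]
  refine tsum_congr (fun k => ?_)
  rw [hp', smul_eq_mul, mul_comm]

section
variable {f : Multigraph → ℝ} {κ : ℝ}

theorem sum_univ_map {n : ℕ} (D : Fin n → ℕ) :
    ((((Finset.univ : Finset (Fin n)).val.map D).sum : ℕ) : ℝ) = ∑ i, (D i : ℝ) := by
  have : ((Finset.univ : Finset (Fin n)).val.map D).sum = ∑ i, D i := rfl
  rw [this]; push_cast; rfl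

theorem count_univ_map {n : ℕ} (D : Fin n → ℕ) (k : ℕ) :
    ((((Finset.univ : Finset (Fin n)).val.map D).count k : ℕ) : ℝ) =
      ∑ i, if D i = k then (1 : ℝ) else 0 := by
  rw [Multiset.count_map, Finset.sum_boole]
  congr 1
  simp [Finset.card, eq_comm]

variable {ν : Measure ℕ} [IsProbabilityMeasure ν]

theorem integrable_count (n k : ℕ) :
    Integrable (fun D : Fin n → ℕ =>
      ((((Finset.univ : Finset (Fin n)).val.map D).count k : ℕ) : ℝ)) (Measure.pi fun _ => ν) := by
  refine Integrable.of_bound (C := n) (Measurable.of_discrete).aestronglyMeasurable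
    (Filter.Eventually.of_forall (fun D => ?_))
  rw [Real.norm_of_nonneg (by positivity)]
  have := Multiset.count_le_card k ((Finset.univ : Finset (Fin n)).val.map D)
  have h2 : ((Finset.univ : Finset (Fin n)).val.map D).card = n := by simp
  rw [h2] at this
  exact_mod_cast this

theorem integral_ind (k : ℕ) : ∫ x : ℕ, (if x = k then (1 : ℝ) else 0) ∂ν = ν.real {k} := by
  have : (fun x : ℕ => if x = k then (1 : ℝ) else 0) = Set.indicator {k} 1 := by
    funext x
    simp [Set.indicator_apply]
  rw [this, integral_indicator_one (measurableSet_singleton k)]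

theorem integral_deg_count (n k : ℕ) :
    ∫ D : Fin n → ℕ, ((((Finset.univ : Finset (Fin n)).val.map D).count k : ℕ) : ℝ)
      ∂(Measure.pi fun _ => ν) = n * ν.real {k} := by
  simp_rw [count_univ_map]
  rw [integral_finsetSum]
  · have : ∀ i : Fin n, ∫ D : Fin n → ℕ, (if D i = k then (1 : ℝ) else 0)
        ∂(Measure.pi fun _ => ν) = ν.real {k} := by
      intro i
      rw [integral_comp_eval (μ := fun _ : Fin n => ν) (i := i)
        (f := fun x : ℕ => if x = k then (1 : ℝ) else 0)
        (Measurable.of_discrete).aestronglyMeasurable, integral_ind]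
    simp [this]
  · intro i _
    refine Integrable.of_bound (C := 1) (Measurable.of_discrete).aestronglyMeasurable
      (Filter.Eventually.of_forall (fun D => ?_))
    split_ifs <;> simp

theorem integral_abs_count (n k : ℕ) (hn : 1 ≤ n) :
    ∫ D : Fin n → ℕ, |((((Finset.univ : Finset (Fin n)).val.map D).count k : ℕ) : ℝ)
      - n * ν.real {k}| ∂(Measure.pi fun _ => ν) ≤ √n := by
  have hn0 : (0 : ℝ) < n := by exact_mod_cast hn
  have hs0 : 0 < √(n : ℝ) := Real.sqrt_pos.2 hn0
  have hss : √(n : ℝ) * √n = n := Real.mul_self_sqrt hn0.le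
  let N : (Fin n → ℕ) → ℝ := fun D =>
    ((((Finset.univ : Finset (Fin n)).val.map D).count k : ℕ) : ℝ)
  have hN : N = ∑ i : Fin n, fun D : Fin n → ℕ => if D i = k then (1 : ℝ) else 0 := by
    funext D
    simp only [N, count_univ_map, Finset.sum_apply]
  have hmem : MemLp (fun x : ℕ => if x = k then (1 : ℝ) else 0) 2 ν := by
    refine MemLp.of_bound (Measurable.of_discrete).aestronglyMeasurable 1
      (Filter.Eventually.of_forall (fun D => ?_))
    split_ifs <;> simp
  have hvar := ProbabilityTheory.variance_sum_pi (μ := fun _ : Fin n => ν)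
    (X := fun _ x => if x = k then (1 : ℝ) else 0) (fun _ => hmem)
  rw [← hN] at hvar
  have hvar1 : ProbabilityTheory.variance (fun x : ℕ => if x = k then (1 : ℝ) else 0) ν ≤ 1 := by
    have := ProbabilityTheory.variance_le_sq_of_bounded (μ := ν) (a := 0) (b := 1)
      (X := fun x : ℕ => if x = k then (1 : ℝ) else 0)
      (Filter.Eventually.of_forall (fun D => by split_ifs <;> simp))
      (Measurable.of_discrete).aemeasurable
    norm_num at this ⊢
    linarith
  have hvarn : ProbabilityTheory.variance N (Measure.pi fun _ : Fin n => ν) ≤ n := by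
    rw [hvar]
    refine (Finset.sum_le_sum (fun i _ => hvar1)).trans ?_
    simp
  rw [ProbabilityTheory.variance_eq_integral (Measurable.of_discrete).aemeasurable] at hvarn
  have hmean : ∫ D, N D ∂(Measure.pi fun _ : Fin n => ν) = n * ν.real {k} := integral_deg_count n k
  rw [hmean] at hvarn
  have hbd : ∀ D, |N D| ≤ n := by
    intro D
    rw [abs_of_nonneg (by simp only [N]; positivity)]
    have := Multiset.count_le_card k ((Finset.univ : Finset (Fin n)).val.map D)
    have h2 : ((Finset.univ : Finset (Fin n)).val.map D).card = n := by simp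
    rw [h2] at this
    simp only [N]
    exact_mod_cast this
  have hi1 : Integrable (fun D => |N D - n * ν.real {k}|) (Measure.pi fun _ : Fin n => ν) :=
    ((integrable_count n k).sub (integrable_const _)).abs
  have hi2 : Integrable (fun D => (N D - n * ν.real {k}) ^ 2) (Measure.pi fun _ : Fin n => ν) := by
    refine Integrable.of_bound (C := (n + |n * ν.real {k}|) ^ 2)
      (Measurable.of_discrete).aestronglyMeasurable (Filter.Eventually.of_forall (fun D => ?_))
    rw [Real.norm_of_nonneg (by positivity), ← sq_abs]
    have := abs_sub (N D) (n * ν.real {k})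
    have h2 := hbd D
    gcongr
    linarith
  have hle : ∫ D, |N D - n * ν.real {k}| ∂(Measure.pi fun _ : Fin n => ν) ≤
      ∫ D, ((N D - n * ν.real {k}) ^ 2 * (2 * √n)⁻¹ + √n / 2) ∂(Measure.pi fun _ : Fin n => ν) := by
    refine integral_mono hi1 ((hi2.mul_const _).add (integrable_const _)) (fun D => ?_)
    simp only
    rw [← sq_abs (N D - n * ν.real {k})]
    set x := |N D - n * ν.real {k}|
    rw [← div_eq_mul_inv, ← sub_nonneg]
    have : x ^ 2 / (2 * √n) + √n / 2 - x = (x - √n) ^ 2 / (2 * √n) := by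
      field_simp; ring
    rw [this]; positivity
  refine hle.trans ?_
  rw [integral_add (hi2.mul_const _) (integrable_const _), integral_mul_const]
  simp only [integral_const, probReal_univ, one_smul]
  have h3 : (∫ D, (N D - n * ν.real {k}) ^ 2 ∂(Measure.pi fun _ : Fin n => ν)) * (2 * √n)⁻¹ ≤
      √n / 2 := by
    rw [← div_eq_mul_inv, div_le_iff₀ (by positivity)]
    nlinarith
  linarith

theorem integrable_sum (hintg : Integrable (fun k : ℕ => (k : ℝ)) ν) (n : ℕ) :
    Integrable (fun D : Fin n → ℕ =>
      ((((Finset.univ : Finset (Fin n)).val.map D).sum : ℕ) : ℝ)) (Measure.pi fun _ => ν) := by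
  simp_rw [sum_univ_map]
  exact integrable_finsetSum _ (fun i _ => integrable_comp_eval (μ := fun _ : Fin n => ν) (i := i)
    (f := fun x : ℕ => (x : ℝ)) hintg)

theorem integral_sum (hintg : Integrable (fun k : ℕ => (k : ℝ)) ν) (n : ℕ) :
    ∫ D : Fin n → ℕ, ((((Finset.univ : Finset (Fin n)).val.map D).sum : ℕ) : ℝ)
      ∂(Measure.pi fun _ => ν) = n * ∫ k : ℕ, (k : ℝ) ∂ν := by
  simp_rw [sum_univ_map]
  rw [integral_finsetSum _ (fun i _ => integrable_comp_eval (μ := fun _ : Fin n => ν) (i := i)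
    (f := fun x : ℕ => (x : ℝ)) hintg)]
  have : ∀ i : Fin n, ∫ D : Fin n → ℕ, (D i : ℝ) ∂(Measure.pi fun _ => ν) = ∫ k : ℕ, (k : ℝ) ∂ν := by
    intro i
    rw [integral_comp_eval (μ := fun _ : Fin n => ν) (i := i)
        (f := fun x : ℕ => (x : ℝ)) hintg.aestronglyMeasurable]
  simp [this]

theorem iid_bound (hinv : GraphParam.Invariant f) (hadd : GraphParam.Additive f)
    (hlip : GraphParam.Lipschitz f κ) {μ : ℕ → ℝ}
    (hν : ∀ k, ν.real {k} = μ k) (hintg : Integrable (fun k : ℕ => (k : ℝ)) ν)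
    (n : ℕ) (hn : 1 ≤ n) (s : Multiset ℕ) (K : ℕ) :
    |iidExpect μ n f - (Dm f s + fpt f * n)| ≤ 2 * κ * ((∑ k ∈ Finset.range K, (k : ℝ) *
      (√n + |n * μ k - s.count k|)) + (n * (∫ k : ℕ, (k : ℝ) ∂ν) -
        ∑ k ∈ Finset.range K, (k : ℝ) * (n * μ k)) + (s.sum - low K s)) := by
  have hκ := kappa_nonneg hlip
  let P := Measure.pi (fun _ : Fin n => ν)
  let S : (Fin n → ℕ) → Multiset ℕ := fun D => (Finset.univ : Finset (Fin n)).val.map D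
  have hDint : Integrable (fun D => Dm f (S D)) P := by
    refine Integrable.mono' ((integrable_sum hintg n).const_mul (2 * κ))
      (Measurable.of_discrete).aestronglyMeasurable (Filter.Eventually.of_forall (fun D => ?_))
    have h := Dm_lip hinv hadd hlip 0 (S D)
    rw [zero_add, Dm_zero hinv hadd, sub_zero] at h
    exact h
  have hcint : Integrable (fun D => configExpect (Fin n) D f) P := by
    have : (fun D => configExpect (Fin n) D f) = fun D => Dm f (S D) + fpt f * n := by
      funext D
      rw [configExpect_eq_Dm hinv]; simp [S]
    rw [this]
    exact hDint.add (integrable_const _)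
  have h1 : iidExpect μ n f = ∫ D, configExpect (Fin n) D f ∂P := by
    rw [integral_countable hcint]
    unfold iidExpect
    refine tsum_congr (fun D => ?_)
    rw [measureReal_def, Measure.pi_singleton, ENNReal.toReal_prod, smul_eq_mul]
    congr 1
    refine Finset.prod_congr rfl (fun i _ => ?_)
    rw [← hν, measureReal_def]
  have h2 : iidExpect μ n f - (Dm f s + fpt f * n) = ∫ D, (Dm f (S D) - Dm f s) ∂P := by
    rw [h1, integral_sub hDint (integrable_const _)]
    have : (fun D => configExpect (Fin n) D f) = fun D => Dm f (S D) + fpt f * n := by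
      funext D
      rw [configExpect_eq_Dm hinv]; simp [S]
    rw [this, integral_add hDint (integrable_const _)]
    simp only [integral_const, probReal_univ, one_smul, P]
    ring
  have hlowint : ∀ K, Integrable (fun D => low K (S D)) P := by
    intro K
    unfold low
    exact integrable_finsetSum _ (fun k _ => (integrable_count n k).const_mul _)
  have habsint : ∀ k, Integrable (fun D => |((S D).count k : ℝ) - s.count k|) P := fun k =>
    ((integrable_count n k).sub (integrable_const _)).abs
  have hsumabs : Integrable (fun D => ∑ k ∈ Finset.range K,
      (k : ℝ) * |((S D).count k : ℝ) - s.count k|) P :=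
    integrable_finsetSum _ (fun k _ => (habsint k).const_mul _)
  have hsl : Integrable (fun D => ((S D).sum : ℝ) - low K (S D)) P :=
    (integrable_sum hintg n).sub (hlowint K)
  have h3 : |∫ D, (Dm f (S D) - Dm f s) ∂P| ≤
      ∫ D, 2 * κ * ((∑ k ∈ Finset.range K, (k : ℝ) * |((S D).count k : ℝ) - s.count k|)
      + ((S D).sum - low K (S D)) + (s.sum - low K s)) ∂P := by
    refine (abs_integral_le_integral_abs).trans ?_
    refine integral_mono (hDint.sub (integrable_const _)).abs
      (((hsumabs.add hsl).add (integrable_const _)).const_mul _) (fun D => ?_)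
    exact Dm_dist hinv hadd hlip (S D) s K
  rw [h2]
  refine h3.trans ?_
  have hss : Integrable (fun D => (∑ k ∈ Finset.range K,
      (k : ℝ) * |((S D).count k : ℝ) - s.count k|) + (((S D).sum : ℝ) - low K (S D))) P :=
    hsumabs.add hsl
  rw [integral_const_mul, integral_add hss (integrable_const _),
    integral_add hsumabs hsl, integral_sub (integrable_sum hintg n) (hlowint K),
    integral_sum hintg n]
  simp only [integral_const, probReal_univ, one_smul, P]
  have h4 : ∫ D, low K (S D) ∂P = ∑ k ∈ Finset.range K, (k : ℝ) * (n * μ k) := by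
    unfold low
    rw [integral_finsetSum _ (fun k _ => (integrable_count n k).const_mul _)]
    refine Finset.sum_congr rfl (fun k _ => ?_)
    rw [integral_const_mul, integral_deg_count, hν]
  have h5 : ∫ D, ∑ k ∈ Finset.range K, (k : ℝ) * |((S D).count k : ℝ) - s.count k| ∂P ≤
      ∑ k ∈ Finset.range K, (k : ℝ) * (√n + |n * μ k - s.count k|) := by
    rw [integral_finsetSum _ (fun k _ => (habsint k).const_mul _)]
    refine Finset.sum_le_sum (fun k _ => ?_)
    rw [integral_const_mul]
    refine mul_le_mul_of_nonneg_left ?_ (by positivity)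
    have hi : Integrable (fun D => |((S D).count k : ℝ) - n * ν.real {k}|) P :=
      ((integrable_count n k).sub (integrable_const _)).abs
    have : ∫ D, |((S D).count k : ℝ) - s.count k| ∂P ≤
        ∫ D, (|((S D).count k : ℝ) - n * ν.real {k}| + |n * μ k - s.count k|) ∂P := by
      refine integral_mono (habsint k) (hi.add (integrable_const _)) (fun D => ?_)
      simp only [hν]
      exact abs_sub_le _ _ _
    refine this.trans ?_
    rw [integral_add hi (integrable_const _)]
    simp only [integral_const, probReal_univ, one_smul, P]
    have := integral_abs_count (ν := ν) n k hn
    simp only [S]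
    linarith
  have h5' : ∫ D, ∑ k ∈ Finset.range K, (k : ℝ) * |((S D).count k : ℝ) - s.count k|
      ∂(Measure.pi fun _ : Fin n => ν) ≤
      ∑ k ∈ Finset.range K, (k : ℝ) * (√n + |n * μ k - s.count k|) := h5
  have h4' : ∫ D, low K (S D) ∂(Measure.pi fun _ : Fin n => ν) =
      ∑ k ∈ Finset.range K, (k : ℝ) * (n * μ k) := h4
  refine mul_le_mul_of_nonneg_left ?_ (by positivity)
  rw [h4']
  linarith

end

theorem iid_limit {f : Multigraph → ℝ} {κ : ℝ}
    (hinv : GraphParam.Invariant f) (hadd : GraphParam.Additive f)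
    (hlip : GraphParam.Lipschitz f κ)
    {μ : ℕ → ℝ} (hμ0 : ∀ k, 0 ≤ μ k) (hμ1 : HasSum μ 1)
    (hμmean : Summable fun k : ℕ => (k : ℝ) * μ k)
    {s : ℕ → Multiset ℕ}
    (hs1 : ∀ k, Tendsto (fun n => ((s n).count k : ℝ) / n) atTop (𝓝 (μ k)))
    (hs2 : Tendsto (fun n => ((s n).sum : ℝ) / n) atTop (𝓝 (∑' k : ℕ, (k : ℝ) * μ k)))
    {L : ℝ} (hL : Tendsto (fun n => Dm f (s n) / n) atTop (𝓝 L)) :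
    Tendsto (fun n => iidExpect μ n f / (n : ℝ)) atTop (𝓝 (L + fpt f)) := by
  have hκ := kappa_nonneg hlip
  obtain ⟨ν, hprob, hν, hintg, hb'⟩ := exists_nu hμ0 hμ1 hμmean
  set b := ∑' k : ℕ, (k : ℝ) * μ k with hb
  have key : Tendsto (fun n => iidExpect μ n f / (n : ℝ) - (Dm f (s n) / n + fpt f)) atTop (𝓝 0) := by
    rw [Metric.tendsto_nhds]
    intro ε hε
    have hτ : Tendsto (fun K => 4 * κ * (b - ∑ k ∈ Finset.range K, (k : ℝ) * μ k)) atTop (𝓝 0) := by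
      have := ((hμmean.hasSum.tendsto_sum_nat).const_sub b).const_mul (4 * κ)
      simpa [hb] using this
    obtain ⟨K, hK⟩ := (hτ.eventually (gt_mem_nhds hε)).exists
    set τ := b - ∑ k ∈ Finset.range K, (k : ℝ) * μ k with hτd
    have hsq : Tendsto (fun n : ℕ => (√(n : ℝ))⁻¹) atTop (𝓝 0) :=
      tendsto_inv_atTop_zero.comp (Real.tendsto_sqrt_atTop.comp tendsto_natCast_atTop_atTop)
    have hlow : Tendsto (fun n => low K (s n) / n) atTop
        (𝓝 (∑ k ∈ Finset.range K, (k : ℝ) * μ k)) := by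
      have : Tendsto (fun n => ∑ k ∈ Finset.range K, (k : ℝ) * (((s n).count k : ℝ) / n)) atTop
        (𝓝 (∑ k ∈ Finset.range K, (k : ℝ) * μ k)) :=
        tendsto_finsetSum _ (fun k _ => (hs1 k).const_mul _)
      refine this.congr (fun n => ?_)
      unfold low
      rw [Finset.sum_div]
      refine Finset.sum_congr rfl (fun k _ => by ring)
    have t1 : Tendsto (fun n : ℕ => ∑ k ∈ Finset.range K, (k : ℝ) *
        ((√(n : ℝ))⁻¹ + |μ k - ((s n).count k : ℝ) / n|)) atTop
        (𝓝 (∑ k ∈ Finset.range K, (k : ℝ) * (0 + |μ k - μ k|))) :=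
      tendsto_finsetSum _ (fun k _ => (hsq.add ((hs1 k).const_sub _).abs).const_mul _)
    have t2 := (((t1.add_const τ).add (hs2.sub hlow)).const_mul (2 * κ))
    have e : 2 * κ * ((∑ k ∈ Finset.range K, (k : ℝ) * (0 + |μ k - μ k|)) + τ +
        (b - ∑ k ∈ Finset.range K, (k : ℝ) * μ k)) = 4 * κ * τ := by
      simp only [sub_self, abs_zero, add_zero, mul_zero, Finset.sum_const_zero]
      rw [← hτd]; ring
    rw [e] at t2
    filter_upwards [t2.eventually (gt_mem_nhds hK), eventually_ge_atTop 1] with n h1 hn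
    have hn0 : (0 : ℝ) < n := by exact_mod_cast hn
    have h2 := iid_bound hinv hadd hlip hν hintg n hn (s n) K
    rw [hb'] at h2
    rw [dist_zero_right, Real.norm_eq_abs]
    refine lt_of_le_of_lt ?_ h1
    have e1 : iidExpect μ n f / (n : ℝ) - (Dm f (s n) / n + fpt f) =
        (iidExpect μ n f - (Dm f (s n) + fpt f * n)) / n := by field_simp
    rw [e1, abs_div, abs_of_pos hn0, div_le_iff₀ hn0]
    refine h2.trans (le_of_eq ?_)
    have e2 : (∑ k ∈ Finset.range K, (k : ℝ) *
        ((√(n : ℝ))⁻¹ + |μ k - ((s n).count k : ℝ) / n|)) * n =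
        ∑ k ∈ Finset.range K, (k : ℝ) * (√n + |n * μ k - (s n).count k|) := by
      rw [Finset.sum_mul]
      refine Finset.sum_congr rfl (fun k _ => ?_)
      rw [mul_assoc, add_mul]
      congr 2
      · rw [inv_mul_eq_div, Real.div_sqrt]
      · nth_rewrite 2 [← abs_of_pos hn0]
        rw [← abs_mul]
        congr 1
        field_simp
    have e3 : ∑ k ∈ Finset.range K, (k : ℝ) * (n * μ k) =
        n * ∑ k ∈ Finset.range K, (k : ℝ) * μ k := by
      rw [Finset.mul_sum]
      exact Finset.sum_congr rfl (fun k _ => by ring)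
    have e4 : ∀ A B S l : ℝ, 2 * κ * (A * n + (n * b - n * B) + (S - l)) =
        2 * κ * (A + (b - B) + (S / n - l / n)) * n := by
      intro A B S l
      field_simp
    rw [← e2, e3, hτd]
    exact e4 _ _ _ _
  have := key.add (hL.add_const (fpt f))
  simpa using this

/-! ### Concentration over random permutations -/

theorem decomp_mul {n : ℕ} (p : Fin (n + 1)) (e : Equiv.Perm (Fin n)) :
    Equiv.Perm.decomposeFin.symm (p, e) =
      Equiv.swap 0 p * Equiv.Perm.decomposeFin.symm (0, e) := by
  ext x
  refine Fin.cases ?_ (fun i => ?_) x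
  · simp
  · simp

theorem decomp_swap {n : ℕ} (a b : Fin n) (e : Equiv.Perm (Fin n)) :
    Equiv.Perm.decomposeFin.symm ((0 : Fin (n + 1)), Equiv.swap a b * e) =
      Equiv.swap a.succ b.succ * Equiv.Perm.decomposeFin.symm (0, e) := by
  ext x
  refine Fin.cases ?_ (fun i => ?_) x
  · simp [Equiv.swap_apply_of_ne_of_ne (Fin.succ_ne_zero a).symm (Fin.succ_ne_zero b).symm]
  · simp only [Equiv.Perm.decomposeFin_symm_apply_succ, Equiv.Perm.coe_mul, Function.comp,
      Equiv.swap_self, Equiv.refl_apply]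
    rw [Function.Injective.map_swap (Fin.succ_injective n)]

theorem expect_decomp {n : ℕ} (F : Equiv.Perm (Fin (n + 1)) → ℝ) :
    𝔼 σ, F σ = 𝔼 p : Fin (n + 1), 𝔼 e : Equiv.Perm (Fin n),
      F (Equiv.Perm.decomposeFin.symm (p, e)) := by
  rw [← Finset.expect_product', Finset.univ_product_univ]
  exact Fintype.expect_equiv Equiv.Perm.decomposeFin _ _ (fun σ => by simp)

theorem exp_step {ι : Type} [Fintype ι] [Nonempty ι] (X : ι → ℝ) (c : ℝ)
    (hc : c ≤ 1) (h : ∀ i, |X i| ≤ c) (h0 : 𝔼 i, X i = 0) :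
    𝔼 i, Real.exp (X i) ≤ Real.exp (c ^ 2) := by
  have h1 : ∀ i, Real.exp (X i) ≤ 1 + X i + c ^ 2 := by
    intro i
    have := Real.abs_exp_sub_one_sub_id_le ((h i).trans hc)
    have h2 : X i ^ 2 ≤ c ^ 2 := by
      rw [← sq_abs (X i)]
      exact pow_le_pow_left₀ (abs_nonneg _) (h i) 2
    linarith [(abs_le.1 this).2]
  calc 𝔼 i, Real.exp (X i) ≤ 𝔼 i, (1 + X i + c ^ 2) :=
        Finset.expect_le_expect (fun i _ => h1 i)
    _ = 1 + c ^ 2 := by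
        rw [Finset.expect_add_distrib, Finset.expect_add_distrib, h0,
          Finset.expect_const Finset.univ_nonempty, Finset.expect_const Finset.univ_nonempty]
        ring
    _ ≤ _ := by linarith [Real.add_one_le_exp (c ^ 2)]

theorem perm_mgf (n : ℕ) (g : Equiv.Perm (Fin n) → ℝ) (L l : ℝ) (hl : |l| * (2 * L) ≤ 1)
    (hg : ∀ a b σ, |g (Equiv.swap a b * σ) - g σ| ≤ L) :
    𝔼 σ, Real.exp (l * (g σ - 𝔼 τ, g τ)) ≤ Real.exp (4 * l ^ 2 * L ^ 2 * n) := by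
  induction n with
  | zero =>
    have : ∀ σ, g σ = 𝔼 τ, g τ := by
      intro σ
      rw [Finset.expect_congr rfl (g := fun _ => g σ)
        (fun τ _ => congrArg g (Subsingleton.elim τ σ)), Finset.expect_const Finset.univ_nonempty]
    simp [← this]
  | succ n ih =>
    let dd : Fin (n + 1) → Equiv.Perm (Fin n) → Equiv.Perm (Fin (n + 1)) :=
      fun p e => Equiv.Perm.decomposeFin.symm (p, e)
    let h : Fin (n + 1) → ℝ := fun p => 𝔼 e, g (dd p e)
    have hA : 𝔼 τ, g τ = 𝔼 p, h p := expect_decomp g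
    have hL : 0 ≤ L := (abs_nonneg _).trans (hg 0 0 1)
    have hh0 : ∀ p, |h p - h 0| ≤ L := by
      intro p
      simp only [h]
      rw [← Finset.expect_sub_distrib]
      refine (Finset.abs_expect_le _ _).trans (Finset.expect_le Finset.univ_nonempty (fun e _ => ?_))
      simp only [dd]
      rw [decomp_mul p e]
      exact hg _ _ _
    have hh : ∀ p, |h p - 𝔼 q, h q| ≤ 2 * L := by
      intro p
      have : h p - 𝔼 q, h q = 𝔼 q, (h p - h q) := by
        rw [Finset.expect_sub_distrib, Finset.expect_const Finset.univ_nonempty]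
      rw [this]
      refine (Finset.abs_expect_le _ _).trans (Finset.expect_le Finset.univ_nonempty (fun q _ => ?_))
      have h1 := abs_le.1 (hh0 p)
      have h2 := abs_le.1 (hh0 q)
      rw [abs_le]
      constructor <;> linarith [h1.1, h1.2, h2.1, h2.2]
    have hin : ∀ p, 𝔼 e, Real.exp (l * (g (dd p e) - h p)) ≤ Real.exp (4 * l ^ 2 * L ^ 2 * n) := by
      intro p
      refine ih (fun e => g (dd p e)) (fun a b e => ?_)
      simp only [dd]
      rw [decomp_mul p, decomp_mul p e, decomp_swap, ← mul_assoc, Equiv.mul_swap_eq_swap_mul,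
        mul_assoc]
      exact hg _ _ _
    have hout : 𝔼 p, Real.exp (l * (h p - 𝔼 q, h q)) ≤ Real.exp ((|l| * (2 * L)) ^ 2) := by
      refine exp_step (fun p => l * (h p - 𝔼 q, h q)) _ hl (fun p => ?_) ?_
      · rw [abs_mul]
        exact mul_le_mul_of_nonneg_left (hh p) (abs_nonneg _)
      · rw [← Finset.mul_expect, Finset.expect_sub_distrib,
          Finset.expect_const Finset.univ_nonempty, sub_self, mul_zero]
    rw [expect_decomp, hA]
    calc 𝔼 p, 𝔼 e, Real.exp (l * (g (dd p e) - 𝔼 q, h q))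
        = 𝔼 p, Real.exp (l * (h p - 𝔼 q, h q)) * 𝔼 e, Real.exp (l * (g (dd p e) - h p)) := by
          refine Finset.expect_congr rfl (fun p _ => ?_)
          rw [Finset.mul_expect]
          refine Finset.expect_congr rfl (fun e _ => ?_)
          rw [← Real.exp_add]
          congr 1; ring
      _ ≤ 𝔼 p, Real.exp (l * (h p - 𝔼 q, h q)) * Real.exp (4 * l ^ 2 * L ^ 2 * n) :=
          Finset.expect_le_expect (fun p _ => mul_le_mul_of_nonneg_left (hin p) (Real.exp_pos _).le)
      _ = (𝔼 p, Real.exp (l * (h p - 𝔼 q, h q))) * Real.exp (4 * l ^ 2 * L ^ 2 * n) := by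
          rw [Finset.expect_mul]
      _ ≤ Real.exp ((|l| * (2 * L)) ^ 2) * Real.exp (4 * l ^ 2 * L ^ 2 * n) :=
          mul_le_mul_of_nonneg_right hout (Real.exp_pos _).le
      _ = _ := by
          rw [← Real.exp_add, mul_pow, sq_abs]
          congr 1
          push_cast; ring

theorem perm_mgf' {H : Type} [Fintype H] (g : Equiv.Perm H → ℝ) (L l : ℝ)
    (hl : |l| * (2 * L) ≤ 1) (hg : ∀ a b σ, |g (Equiv.swap a b * σ) - g σ| ≤ L) :
    𝔼 σ, Real.exp (l * (g σ - 𝔼 τ, g τ)) ≤ Real.exp (4 * l ^ 2 * L ^ 2 * Fintype.card H) := by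
  let e : H ≃ Fin (Fintype.card H) := Fintype.equivFin H
  let E : Equiv.Perm (Fin (Fintype.card H)) ≃ Equiv.Perm H := e.symm.permCongr
  have h := perm_mgf (Fintype.card H) (fun σ => g (E σ)) L l hl (by
    intro a b σ
    have : E (Equiv.swap a b * σ) = Equiv.swap (e.symm a) (e.symm b) * E σ := by
      ext x
      simp only [E, Equiv.permCongr_apply, Equiv.Perm.coe_mul, Function.comp,
        Function.Injective.map_swap e.symm.injective]
    rw [this]
    exact hg _ _ _)
  have h1 : 𝔼 τ, g (E τ) = 𝔼 τ, g τ := Fintype.expect_equiv E _ _ (fun _ => rfl)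
  rw [h1] at h
  refine le_trans (le_of_eq ?_) h
  exact (Fintype.expect_equiv E _ _ (fun _ => rfl)).symm

theorem isM_split_swap {H : Type} (x y : H) {E : Multiset (Sym2 H)} (hE : IsM E) :
    ∃ E₀ R : Multiset (Sym2 H), E = E₀ + R ∧ R.card ≤ 2 ∧ ∀ e ∈ E₀, x ∉ e ∧ y ∉ e := by
  refine ⟨E.filter (fun e => ¬ (x ∈ e ∨ y ∈ e)), E.filter (fun e => x ∈ e ∨ y ∈ e), ?_, ?_, ?_⟩
  · rw [add_comm, Multiset.filter_add_not]
  · have h1 : ∀ z : H, (E.filter (fun e => z ∈ e)).card ≤ 1 := by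
      intro z
      have hn : ((endp E).count z) ≤ 1 := Multiset.nodup_iff_count_le_one.1 hE z
      refine le_trans ?_ hn
      clear hn hE
      induction E using Multiset.induction_on with
      | empty => simp
      | cons e E ih =>
        rw [endp_cons, Multiset.count_add]
        by_cases hz : z ∈ e
        · rw [Multiset.filter_cons_of_pos (p := fun e => z ∈ e) _ hz, Multiset.card_cons]
          have : 1 ≤ e.toMultiset.count z := Multiset.one_le_count_iff_mem.2 (by simpa using hz)
          omega
        · rw [Multiset.filter_cons_of_neg (p := fun e => z ∈ e) _ hz]
          omega
    have h2 := Multiset.filter_add_filter (fun e => x ∈ e) (fun e => y ∈ e) E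
    have h3 := congrArg Multiset.card h2
    simp only [Multiset.card_add] at h3
    have := h1 x
    have := h1 y
    omega
  · intro e he
    rw [Multiset.mem_filter, not_or] at he
    exact he.2

theorem swap_lip {f : Multigraph → ℝ} {κ : ℝ} (hlip : GraphParam.Lipschitz f κ)
    {V H : Type} [Fintype V] (ℓ : H → V) {E : Multiset (Sym2 H)} (hE : IsM E)
    (a b : H) (σ : Equiv.Perm H) :
    |f (gr (ℓ ∘ (Equiv.swap a b * σ : Equiv.Perm H)) E) - f (gr (ℓ ∘ σ) E)| ≤ 4 * κ := by
  have hκ := kappa_nonneg hlip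
  obtain ⟨E₀, R, rfl, hR, h0⟩ := isM_split_swap (σ⁻¹ a) (σ⁻¹ b) hE
  have e : gr (ℓ ∘ (Equiv.swap a b * σ : Equiv.Perm H)) E₀ = gr (ℓ ∘ σ) E₀ := by
    unfold gr
    congr 1
    refine Multiset.map_congr rfl (fun e he => ?_)
    refine Sym2.map_congr (fun z hz => ?_)
    simp only [Function.comp, Equiv.Perm.coe_mul]
    rw [Equiv.swap_apply_of_ne_of_ne]
    · rintro rfl; exact (h0 e he).1 (by simpa using hz)
    · rintro rfl; exact (h0 e he).2 (by simpa using hz)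
  have a1 := lip_gr_add hlip (ℓ ∘ (Equiv.swap a b * σ : Equiv.Perm H)) E₀ R
  have a2 := lip_gr_add hlip (ℓ ∘ σ) E₀ R
  rw [e] at a1
  have b1 : κ * (R.card : ℝ) ≤ κ * 2 :=
    mul_le_mul_of_nonneg_left (by exact_mod_cast hR) hκ
  rw [abs_le] at *
  constructor <;> linarith [a1.1, a1.2, a2.1, a2.2]

theorem Av_mgf {f : Multigraph → ℝ} {κ : ℝ} (hlip : GraphParam.Lipschitz f κ)
    {V H : Type} [Fintype V] [Fintype H] (ℓ : H → V) (l : ℝ) (hl : |l| * (8 * κ) ≤ 1) :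
    Av (fun G => Real.exp (l * (f G - Av f ℓ))) ℓ ≤
      Real.exp (64 * l ^ 2 * κ ^ 2 * Fintype.card H) := by
  obtain ⟨m, hm⟩ := maxM_nonempty H
  rw [mem_maxM] at hm
  rw [Av_eq_perm ℓ hm, Av_eq_perm ℓ hm]
  have := perm_mgf' (fun σ : Equiv.Perm H => f (gr (ℓ ∘ σ) m.val)) (4 * κ) l
    (by linarith) (fun a b σ => swap_lip hlip ℓ hm.1 a b σ)
  refine this.trans (le_of_eq ?_)
  congr 1; ring

/-- Two-sided tail bound under the uniform maximal matching. -/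
theorem Av_tail {f : Multigraph → ℝ} {κ : ℝ} (hlip : GraphParam.Lipschitz f κ)
    {V H : Type} [Fintype V] [Fintype H] (ℓ : H → V) (l : ℝ) (hl0 : 0 ≤ l)
    (hl : l * (8 * κ) ≤ 1) (t : ℝ) :
    (((maxM H).filter (fun m => t ≤ |f (gr ℓ m.val) - Av f ℓ|)).card : ℝ) / (maxM H).card ≤
      2 * Real.exp (64 * l ^ 2 * κ ^ 2 * Fintype.card H - l * t) := by
  have h1 := Av_mgf hlip ℓ l (by rwa [abs_of_nonneg hl0])
  have h2 := Av_mgf hlip ℓ (-l) (by rwa [abs_neg, abs_of_nonneg hl0])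
  rw [neg_sq] at h2
  have hc : (0 : ℝ) < (maxM H).card := by exact_mod_cast Finset.card_pos.2 (maxM_nonempty H)
  have h3 : (((maxM H).filter (fun m => t ≤ |f (gr ℓ m.val) - Av f ℓ|)).card : ℝ) * Real.exp (l * t)
      ≤ ∑ m ∈ maxM H, (Real.exp (l * (f (gr ℓ m.val) - Av f ℓ)) +
        Real.exp (-l * (f (gr ℓ m.val) - Av f ℓ))) := by
    rw [← nsmul_eq_mul, ← Finset.sum_const]
    refine (Finset.sum_le_sum (fun m hm => ?_)).trans
      (Finset.sum_le_sum_of_subset_of_nonneg (Finset.filter_subset _ _)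
        (fun m _ _ => by positivity))
    have ht := (Finset.mem_filter.1 hm).2
    rcases le_abs.1 ht with h | h
    · have : Real.exp (l * t) ≤ Real.exp (l * (f (gr ℓ m.val) - Av f ℓ)) :=
        Real.exp_le_exp.2 (mul_le_mul_of_nonneg_left h hl0)
      linarith [Real.exp_pos (-l * (f (gr ℓ m.val) - Av f ℓ))]
    · have : Real.exp (l * t) ≤ Real.exp (-l * (f (gr ℓ m.val) - Av f ℓ)) :=
        Real.exp_le_exp.2 (by nlinarith)
      linarith [Real.exp_pos (l * (f (gr ℓ m.val) - Av f ℓ))]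
  rw [Finset.sum_add_distrib] at h3
  unfold Av at h1 h2
  rw [Finset.expect_eq_sum_div_card, div_le_iff₀ hc] at h1 h2
  rw [div_le_iff₀ hc, Real.exp_sub, ← mul_div_assoc, div_mul_eq_mul_div,
    le_div_iff₀ (Real.exp_pos _)]
  refine h3.trans ?_
  have h4 := add_le_add h1 h2
  refine (le_trans (le_of_eq ?_) h4).trans (le_of_eq ?_)
  · rfl
  · ring

/-! ### Almost sure convergence -/

theorem maximalMatchings_eq {V : Type} [Fintype V] [DecidableEq V] (d : V → ℕ) :
    maximalMatchings V d = maxM (HalfEdge V d) := by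
  ext m; simp [maximalMatchings, maxM]

theorem prob_bound {Ω T : Type} [MeasurableSpace Ω] (P : Measure Ω) [IsProbabilityMeasure P]
    [Fintype T] (A : Finset T) (hA : A.Nonempty) (M : Ω → T)
    (hmeas : ∀ mm, MeasurableSet {ω | M ω = mm})
    (hun : ∀ mm ∈ A, P {ω | M ω = mm} = ((A.card : ℝ≥0∞))⁻¹) (p : T → Prop) :
    P {ω | p (M ω)} ≤ ENNReal.ofReal (((A.filter p).card : ℝ) / A.card) := by
  have hc0 : (A.card : ℝ≥0∞) ≠ 0 := by
    simpa using hA.ne_empty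
  have hsum : ∀ B ⊆ A, P (⋃ mm ∈ B, {ω | M ω = mm}) = (B.card : ℝ≥0∞) * ((A.card : ℝ≥0∞))⁻¹ := by
    intro B hB
    rw [measure_biUnion_finset]
    · rw [Finset.sum_congr rfl (fun mm hmm => hun mm (hB hmm))]
      simp
    · intro a _ b _ hab
      refine Set.disjoint_left.2 (fun ω h1 h2 => hab ?_)
      have h1 : M ω = a := h1
      have h2 : M ω = b := h2
      exact h1.symm.trans h2
    · exact fun mm _ => hmeas mm
  have h1 : P (⋃ mm ∈ A, {ω | M ω = mm}) = 1 := by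
    rw [hsum A (Finset.Subset.refl _)]
    exact ENNReal.mul_inv_cancel hc0 (by simp)
  have h2 : P (⋃ mm ∈ A, {ω | M ω = mm})ᶜ = 0 := by
    rw [prob_compl_eq_zero_iff (Finset.measurableSet_biUnion _ (fun mm _ => hmeas mm))]
    exact h1
  have hsub : {ω | p (M ω)} ⊆ (⋃ mm ∈ A, {ω | M ω = mm})ᶜ ∪
      ⋃ mm ∈ A.filter p, {ω | M ω = mm} := by
    intro ω hω
    by_cases h : M ω ∈ A
    · right
      simp only [Set.mem_iUnion, Set.mem_ofPred_eq]
      exact ⟨M ω, Finset.mem_filter.2 ⟨h, hω⟩, rfl⟩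
    · left
      simp only [Set.mem_compl_iff, Set.mem_iUnion, Set.mem_ofPred_eq, not_exists]
      intro mm hmm e
      exact h (e ▸ hmm)
  refine (measure_mono hsub).trans ((measure_union_le _ _).trans ?_)
  rw [h2, zero_add, hsum _ (Finset.filter_subset _ _)]
  rw [ENNReal.ofReal_div_of_pos (by exact_mod_cast Finset.card_pos.2 hA), ENNReal.ofReal_natCast,
    ENNReal.ofReal_natCast, ENNReal.div_eq_inv_mul, mul_comm]

theorem as_conv {f : Multigraph → ℝ} {κ : ℝ} (hlip : GraphParam.Lipschitz f κ)
    (d : (n : ℕ) → Fin n → ℕ) (C : ℝ) (hC : ∀ n, ∑ i, (d n i : ℝ) ≤ C * n)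
    {Ω : Type} [MeasurableSpace Ω] (P : Measure Ω) [IsProbabilityMeasure P]
    (M : (n : ℕ) → Ω → Finset (Sym2 (HalfEdge (Fin n) (d n))))
    (hmeas : ∀ (n : ℕ) (mm : Finset (Sym2 (HalfEdge (Fin n) (d n)))),
            MeasurableSet {ω | M n ω = mm})
    (hun : ∀ (n : ℕ) (mm : Finset (Sym2 (HalfEdge (Fin n) (d n)))), IsMaximalMatching mm →
            P {ω | M n ω = mm} = (((maximalMatchings (Fin n) (d n)).card : ℝ≥0∞))⁻¹) :
    ∀ᵐ ω ∂P, Tendsto (fun n => f (matchingGraph (Fin n) (d n) (M n ω)) / (n : ℝ) -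
      configExpect (Fin n) (d n) f / n) atTop (𝓝 0) := by
  have hκ := kappa_nonneg hlip
  have hC0 : 0 ≤ C := by
    have := hC 1
    have h2 : (0 : ℝ) ≤ ∑ i, (d 1 i : ℝ) := Finset.sum_nonneg (fun i _ => by positivity)
    simp only [Nat.cast_one, mul_one] at this
    linarith
  have key : ∀ ε : ℝ, 0 < ε → ∀ᵐ ω ∂P, ∀ᶠ n in atTop,
      ¬ (ε * n ≤ |f (matchingGraph (Fin n) (d n) (M n ω)) - configExpect (Fin n) (d n) f|) := by
    intro ε hε
    set D := 128 * κ ^ 2 * C + 8 * κ * ε + 1 with hD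
    have hDpos : 0 < D := by positivity
    set l := ε / D with hl
    have hl0 : 0 < l := by positivity
    have hl1 : l * (8 * κ) ≤ 1 := by
      rw [hl, div_mul_eq_mul_div, div_le_one hDpos, hD]
      have : 0 ≤ 128 * κ ^ 2 * C := by positivity
      nlinarith
    have hl2 : l * (128 * κ ^ 2 * C) ≤ ε := by
      rw [hl, div_mul_eq_mul_div, div_le_iff₀ hDpos, hD]
      have : 0 ≤ 8 * κ * ε + 1 := by positivity
      nlinarith
    have hb : ∀ n, P {ω | ε * n ≤ |f (matchingGraph (Fin n) (d n) (M n ω)) -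
        configExpect (Fin n) (d n) f|} ≤ ENNReal.ofReal (2 * Real.exp (-(l * ε / 2)) ^ n) := by
      intro n
      have h1 := prob_bound P (maxM (HalfEdge (Fin n) (d n))) (maxM_nonempty _) (M n) (hmeas n)
        (by
          intro mm hmm
          rw [hun n mm (by rwa [isMaximalMatching_iff, ← mem_maxM]), maximalMatchings_eq])
        (fun m => ε * n ≤ |f (matchingGraph (Fin n) (d n) m) - configExpect (Fin n) (d n) f|)
      refine h1.trans (ENNReal.ofReal_le_ofReal ?_)
      have h2 := Av_tail hlip (Sigma.fst : HalfEdge (Fin n) (d n) → Fin n) l hl0.le hl1 (ε * n)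
      rw [← configExpect_eq_Av] at h2
      refine le_trans (le_of_eq ?_) (h2.trans ?_)
      · rfl
      · rw [← Real.exp_nat_mul]
        refine mul_le_mul_of_nonneg_left (Real.exp_le_exp.2 ?_) (by norm_num)
        have hcard : (Fintype.card (HalfEdge (Fin n) (d n)) : ℝ) ≤ C * n := by
          rw [card_halfEdge, sum_univ_map]; exact hC n
        have h3 : 64 * l ^ 2 * κ ^ 2 * (Fintype.card (HalfEdge (Fin n) (d n)) : ℝ) ≤
            64 * l ^ 2 * κ ^ 2 * (C * n) := mul_le_mul_of_nonneg_left hcard (by positivity)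
        have h4 : l * n * (l * (128 * κ ^ 2 * C)) ≤ l * n * ε :=
          mul_le_mul_of_nonneg_left hl2 (by positivity)
        nlinarith
    have hsum : ∑' n, P {ω | ε * n ≤ |f (matchingGraph (Fin n) (d n) (M n ω)) -
        configExpect (Fin n) (d n) f|} ≠ ∞ := by
      refine ne_top_of_le_ne_top ?_ (ENNReal.tsum_le_tsum hb)
      have hs : Summable (fun n : ℕ => 2 * Real.exp (-(l * ε / 2)) ^ n) := by
        refine (summable_geometric_of_lt_one (Real.exp_pos _).le ?_).mul_left 2
        rw [Real.exp_lt_one_iff]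
        have : 0 < l * ε := by positivity
        linarith
      exact hs.tsum_ofReal_lt_top.ne
    exact ae_eventually_notMem hsum
  have key2 : ∀ᵐ ω ∂P, ∀ k : ℕ, ∀ᶠ n in atTop,
      ¬ ((1 / ((k : ℝ) + 1)) * n ≤
        |f (matchingGraph (Fin n) (d n) (M n ω)) - configExpect (Fin n) (d n) f|) :=
    ae_all_iff.2 (fun k => key _ (by positivity))
  filter_upwards [key2] with ω hω
  rw [Metric.tendsto_nhds]
  intro ε hε
  obtain ⟨k, hk⟩ := exists_nat_one_div_lt hε
  filter_upwards [hω k, eventually_ge_atTop 1] with n h1 hn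
  have hn0 : (0 : ℝ) < n := by exact_mod_cast hn
  rw [dist_zero_right, Real.norm_eq_abs, ← sub_div, abs_div, abs_of_pos hn0, div_lt_iff₀ hn0]
  rw [not_le] at h1
  exact h1.trans (mul_lt_mul_of_pos_right hk hn0)

theorem statement0 (f : Multigraph → ℝ) (κ : ℝ)
    (hinv : GraphParam.Invariant f) (hadd : GraphParam.Additive f)
    (hlip : GraphParam.Lipschitz f κ) (hconc : GraphParam.Concave f)
    (μ : ℕ → ℝ) (hμ0 : ∀ k, 0 ≤ μ k) (hμ1 : HasSum μ 1)
    (hμmean : Summable fun k : ℕ => (k : ℝ) * μ k)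
    (d : (n : ℕ) → Fin n → ℕ) (hd : Approaches d μ) :
    ∃ Ψ : ℝ,
      Tendsto (fun n => iidExpect μ n f / (n : ℝ)) atTop (nhds Ψ) ∧
      ∀ (Ω : Type) [MeasurableSpace Ω] (P : Measure Ω), IsProbabilityMeasure P →
        ∀ M : (n : ℕ) → Ω → Finset (Sym2 (HalfEdge (Fin n) (d n))),
          (∀ (n : ℕ) (mm : Finset (Sym2 (HalfEdge (Fin n) (d n)))),
            MeasurableSet {ω | M n ω = mm}) →
          (∀ (n : ℕ) (mm : Finset (Sym2 (HalfEdge (Fin n) (d n)))), IsMaximalMatching mm →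
            P {ω | M n ω = mm} = (((maximalMatchings (Fin n) (d n)).card : ℝ≥0∞))⁻¹) →
          ∀ᵐ ω ∂P,
            Tendsto (fun n => f (matchingGraph (Fin n) (d n) (M n ω)) / (n : ℝ))
              atTop (nhds Ψ) := by
  let s : ℕ → Multiset ℕ := fun n => (Finset.univ : Finset (Fin n)).val.map (d n)
  have hs1 : ∀ k, Tendsto (fun n => ((s n).count k : ℝ) / n) atTop (𝓝 (μ k)) := by
    intro k
    refine (hd.1 k).congr (fun n => ?_)
    simp only [s, empirical]
    rw [count_univ_map, Finset.sum_boole]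
  have hs2 : Tendsto (fun n => ((s n).sum : ℝ) / n) atTop (𝓝 (∑' k : ℕ, (k : ℝ) * μ k)) := by
    refine hd.2.congr (fun n => ?_)
    simp only [s]
    rw [sum_univ_map]
  obtain ⟨L, hL⟩ := det_limit hinv hadd hlip hconc hμmean hs1 hs2
  refine ⟨L + fpt f, iid_limit hinv hadd hlip hμ0 hμ1 hμmean hs1 hs2 hL, ?_⟩
  intro Ω _ P hP M hmeas hun
  obtain ⟨C, hC⟩ := hd.2.bddAbove_range
  have hC' : ∀ n, ∑ i, (d n i : ℝ) ≤ C * n := by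
    intro n
    rcases Nat.eq_zero_or_pos n with rfl | hn
    · simp
    · have hn0 : (0 : ℝ) < n := by exact_mod_cast hn
      rw [← div_le_iff₀ hn0]
      exact hC ⟨n, rfl⟩
  have hce : Tendsto (fun n => configExpect (Fin n) (d n) f / n) atTop (𝓝 (L + fpt f)) := by
    refine (hL.add_const (fpt f)).congr' ?_
    filter_upwards [eventually_ge_atTop 1] with n hn
    have hn0 : (n : ℝ) ≠ 0 := by
      have : n ≠ 0 := by omega
      exact_mod_cast this
    rw [configExpect_eq_Dm hinv, Fintype.card_fin]
    simp only [s]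
    field_simp
  filter_upwards [as_conv hlip d C hC' P M hmeas hun] with ω hω
  have := hω.add hce
  simpa using this
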